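/- arXiv:1201.2350 — 3 statements merged into one kernel-verified Lean document; each statement's English description precedes it below -/
import Mathlib

section
/- Suppose F : K → L²(Ω) is Lipschitz. Then for every (X̄, V̄) ∈ K × L²(Ω) there exists a unique Lagrangian solution X with initial data (X̄, V̄). Moreover, for every T ≥ 0 there exists a constant C_T ≥ 0, independent of the initial data, such that ‖X(t)‖_{L²(Ω)} + ‖Ẋ(t)‖_{L²(Ω)} ≤ C_T ( 1 + ‖X̄‖_{L²(Ω)} + ‖V̄‖_{L²(Ω)} ) for almost every t ∈ [0,T]. -/
open MeasureTheory Set Filter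
open scoped ENNReal NNReal RealInnerProductSpace

noncomputable section

/-- The interval `Ω = (0,1)`. -/
def Omg : Set ℝ := Set.Ioo 0 1

/-- Lebesgue measure restricted to `(0,1)`. -/
def mu : Measure ℝ := volume.restrict Omg

/-- The Hilbert space `L²(Ω)`. -/
abbrev L2 : Type := Lp ℝ 2 mu

/-- The cone `K` of functions in `L²(Ω)` admitting a nondecreasing representative. -/
def Kcone : Set L2 := {X | ∃ g : ℝ → ℝ, MonotoneOn g Omg ∧ ⇑X =ᵐ[mu] g}

/-- The normal cone to `K` at `X`. -/
def normalCone (X : L2) : Set L2 := {W | ∀ Y ∈ Kcone, ⟪W, Y - X⟫ ≤ 0}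

/-- A Lagrangian solution with initial data `(X̄, V̄)`: a locally Lipschitz curve
`X : [0,∞) → K` with `X(0) = X̄` such that, with `Y(t) = V̄ + ∫₀ᵗ F[X(s)] ds`, for a.e.
`t > 0` the derivative `Ẋ(t)` exists in `L²(Ω)` and `Y(t) − Ẋ(t) ∈ N_{X(t)} K`. -/
def LagSol (F : L2 → L2) (Xbar Vbar : L2) (X : ℝ → L2) : Prop :=
  (∀ t : ℝ, 0 ≤ t → X t ∈ Kcone) ∧ X 0 = Xbar ∧
  (∀ T : ℝ, ∃ L : ℝ≥0, LipschitzOnWith L X (Set.Icc 0 T)) ∧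
  (∀ᵐ t ∂(volume.restrict (Set.Ioi (0:ℝ))),
    ∃ V : L2, HasDerivAt X V t ∧
      (Vbar + ∫ s in Set.Ioc (0:ℝ) t, F (X s)) - V ∈ normalCone (X t))

open scoped Topology

section Gronwall

/-- An absolutely continuous real function with a.e. nonpositive derivative decreases. -/
lemma AbsolutelyContinuousOnInterval.le_of_ae_deriv_nonpos {q : ℝ → ℝ} {a b : ℝ} (hab : a ≤ b)
    (hq : AbsolutelyContinuousOnInterval q a b)
    (hd : ∀ᵐ t, t ∈ Ioo a b → ∃ d ≤ 0, HasDerivAt q d t) : q b ≤ q a := by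
  rw [← sub_nonpos, ← hq.integral_deriv_eq_sub, intervalIntegral.integral_of_le hab]
  refine integral_nonpos_of_ae ?_
  rw [EventuallyLE, ae_restrict_iff' measurableSet_Ioc]
  have hne : ∀ᵐ t : ℝ, t ≠ b := by simp [ae_iff, measure_singleton]
  filter_upwards [hd, hne] with t ht htb hmem
  obtain ⟨d, hd0, hd⟩ := ht ⟨hmem.1, lt_of_le_of_ne hmem.2 htb⟩
  simpa [hd.deriv] using hd0

/-- Grönwall's inequality for absolutely continuous functions. -/
lemma AbsolutelyContinuousOnInterval.le_exp_mul_of_ae_deriv_le {q : ℝ → ℝ} {K ε T : ℝ}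
    (hK : 0 ≤ K) (hε : 0 ≤ ε) (hT : 0 ≤ T) (hq : AbsolutelyContinuousOnInterval q 0 T)
    (hd : ∀ᵐ t, t ∈ Ioo 0 T → ∃ d ≤ K * q t + ε, HasDerivAt q d t) :
    q T ≤ Real.exp (K * T) * (q 0 + ε * T) := by
  have hexp : AbsolutelyContinuousOnInterval (fun t : ℝ => Real.exp (-K * t)) 0 T :=
    ContDiffOn.absolutelyContinuousOnInterval (by fun_prop)
  have hlin : AbsolutelyContinuousOnInterval (fun t : ℝ => ε * t) 0 T :=
    ContDiffOn.absolutelyContinuousOnInterval (by fun_prop)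
  have key := ((hexp.mul hq).sub hlin).le_of_ae_deriv_nonpos hT (by
    filter_upwards [hd] with t ht htm
    obtain ⟨d, hd1, hd2⟩ := ht htm
    have he : HasDerivAt (fun t : ℝ => Real.exp (-K * t)) (Real.exp (-K * t) * (-K)) t := by
      simpa using ((hasDerivAt_id t).const_mul (-K)).exp
    have hl : HasDerivAt (fun t : ℝ => ε * t) ε t := by
      simpa using (hasDerivAt_id t).const_mul ε
    refine ⟨_, ?_, (he.mul hd2).sub hl⟩
    have h1 : Real.exp (-K * t) ≤ 1 := Real.exp_le_one_iff.2 (by nlinarith [htm.1])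
    have h2 := Real.exp_pos (-K * t)
    nlinarith [mul_le_mul_of_nonneg_left hd1 h2.le])
  simp only [Pi.sub_apply, Pi.mul_apply, mul_zero, Real.exp_zero, one_mul, sub_zero] at key
  have h3 : Real.exp (K * T) * Real.exp (-K * T) = 1 := by
    rw [← Real.exp_add]; simp
  have := mul_le_mul_of_nonneg_left key (Real.exp_pos (K * T)).le
  rw [mul_sub, ← mul_assoc, h3, one_mul] at this
  linarith

/-- Grönwall's inequality for functions with a continuous derivative. -/
lemma le_exp_mul_of_hasDerivAt_le {q d : ℝ → ℝ} {K ε T : ℝ}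
    (hK : 0 ≤ K) (hε : 0 ≤ ε) (hT : 0 ≤ T) (hq : ∀ t, HasDerivAt q (d t) t)
    (hc : Continuous d) (hd : ∀ t ∈ Ioo 0 T, d t ≤ K * q t + ε) :
    q T ≤ Real.exp (K * T) * (q 0 + ε * T) := by
  have hq1 : ContDiff ℝ 1 q := by
    rw [contDiff_one_iff_deriv]
    exact ⟨fun t => (hq t).differentiableAt, by rwa [funext fun t => (hq t).deriv]⟩
  exact (hq1.contDiffOn.absolutelyContinuousOnInterval).le_exp_mul_of_ae_deriv_le hK hε hT
    (Eventually.of_forall fun t ht => ⟨d t, hd t ht, hq t⟩)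

end Gronwall

section Rademacher

variable {H : Type*} [NormedAddCommGroup H] [InnerProductSpace ℝ H]

lemma Orthonormal.countable_of_separableSpace [TopologicalSpace.SeparableSpace H] {ι : Type*}
    {e : ι → H} (he : Orthonormal ℝ e) : Countable ι := by
  have hdist : ∀ i j, i ≠ j → 1 < ‖e i - e j‖ := by
    intro i j hij
    have h := norm_sub_sq_real (e i) (e j)
    rw [he.1 i, he.1 j, he.2 hij] at h
    nlinarith [norm_nonneg (e i - e j)]
  have hcount := Set.PairwiseDisjoint.countable_of_isOpen (a := (univ : Set ι))
    (s := fun i => Metric.ball (e i) (1 / 2)) (by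
      intro i _ j _ hij
      refine Metric.ball_disjoint_ball ?_
      rw [dist_eq_norm]
      linarith [hdist i j hij]) (fun i _ => Metric.isOpen_ball)
      (fun i _ => ⟨e i, by simp⟩)
  exact countable_univ_iff.1 hcount

variable [CompleteSpace H] [TopologicalSpace.SeparableSpace H]

/-- A Lipschitz curve in a separable Hilbert space is differentiable almost everywhere. -/
theorem LipschitzWith.ae_differentiableAt_hilbert {f : ℝ → H} {C : ℝ≥0}
    (hf : LipschitzWith C f) : ∀ᵐ t, DifferentiableAt ℝ f t := by
  obtain ⟨w, e, -⟩ := exists_hilbertBasis ℝ H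
  have hcount : Countable w := e.orthonormal.countable_of_separableSpace
  set c : w → ℝ → ℝ := fun i t => ⟪e i, f t⟫ with hcdef
  have hcLip : ∀ i, LipschitzWith C (c i) := by
    intro i
    refine LipschitzWith.of_dist_le_mul fun s t => ?_
    rw [Real.dist_eq, hcdef, ← inner_sub_right]
    refine (abs_real_inner_le_norm _ _).trans ?_
    rw [e.orthonormal.1 i, one_mul, ← dist_eq_norm]
    exact hf.dist_le_mul s t
  have hcdiff : ∀ᵐ t, ∀ i, DifferentiableAt ℝ (c i) t :=
    ae_all_iff.2 fun i => (hcLip i).ae_differentiableAt_real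
  have hsum : ∀ t, (∀ i, DifferentiableAt ℝ (c i) t) → ∀ s : Finset w,
      ∑ i ∈ s, ‖deriv (c i) t‖ ^ 2 ≤ (C : ℝ) ^ 2 := by
    intro t ht s
    have htend : Tendsto (fun h : ℝ => ∑ i ∈ s, ‖slope (c i) t h‖ ^ 2) (𝓝[≠] t)
        (𝓝 (∑ i ∈ s, ‖deriv (c i) t‖ ^ 2)) :=
      tendsto_finsetSum _ fun i _ =>
        ((hasDerivAt_iff_tendsto_slope.1 (ht i).hasDerivAt).norm.pow 2)
    refine le_of_tendsto htend (eventually_nhdsWithin_of_forall fun h hh => ?_)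
    have hslope : ∀ i, slope (c i) t h = ⟪e i, slope f t h⟫ := by
      intro i
      simp [slope, hcdef, inner_smul_right, inner_sub_right]
    simp only [hslope]
    refine (e.orthonormal.sum_inner_products_le _).trans ?_
    refine pow_le_pow_left₀ (norm_nonneg _) ?_ 2
    have hpos : 0 < ‖h - t‖ := norm_pos_iff.2 (sub_ne_zero.2 hh)
    rw [slope, vsub_eq_sub, norm_smul, norm_inv, inv_mul_le_iff₀ hpos, mul_comm, ← dist_eq_norm,
      ← dist_eq_norm]
    exact hf.dist_le_mul h t
  have hv : ∀ t, (∀ i, DifferentiableAt ℝ (c i) t) → ∃ v : H, ‖v‖ ≤ C ∧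
      (∀ i, ⟪e i, v⟫ = deriv (c i) t) ∧ HasSum (fun i => deriv (c i) t • e i) v := by
    intro t ht
    have hmem : Memℓp (fun i => deriv (c i) t) 2 := by
      rw [memℓp_gen_iff (by norm_num)]
      simpa using summable_of_sum_le (fun i => by positivity) (hsum t ht)
    have hs := e.hasSum_repr_symm ⟨_, hmem⟩
    have hi : ∀ i, ⟪e i, e.repr.symm ⟨_, hmem⟩⟫ = deriv (c i) t := by
      intro i
      rw [← e.repr_apply_apply, LinearIsometryEquiv.apply_symm_apply]
    refine ⟨e.repr.symm ⟨_, hmem⟩, ?_, hi, hs⟩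
    rw [LinearIsometryEquiv.norm_map]
    refine lp.norm_le_of_forall_sum_le (by norm_num) C.coe_nonneg fun s => ?_
    simpa using hsum t ht s
  choose! v hvnorm hvinner hvsum using hv
  have hvmeas : AEStronglyMeasurable v volume := by
    refine aestronglyMeasurable_of_tendsto_ae (atTop : Filter (Finset w))
      (f := fun s t => ∑ i ∈ s, deriv (c i) t • e i) (fun s => ?_) ?_
    · refine Finset.aestronglyMeasurable_fun_sum _ fun i _ => ?_
      exact ((measurable_deriv (c i)).stronglyMeasurable.smul_const (e i)).aestronglyMeasurable
    · filter_upwards [hcdiff] with t ht using hvsum t ht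
  have hvloc : LocallyIntegrable v volume :=
    (locallyIntegrable_const (C : ℝ)).mono hvmeas (by
      filter_upwards [hcdiff] with t ht
      simpa using hvnorm t ht)
  have hvint : ∀ a b, IntervalIntegrable v volume a b := fun a b =>
    intervalIntegrable_iff.2 ((hvloc.integrableOn_isCompact isCompact_uIcc).mono_set
      uIoc_subset_uIcc)
  have hrepr : f = fun t => f 0 + ∫ s in (0:ℝ)..t, v s := by
    funext t
    have hcoord : ∀ i, ⟪e i, f t⟫ = ⟪e i, f 0 + ∫ s in (0:ℝ)..t, v s⟫ := by
      intro i
      have h1 := ((hcLip i).lipschitzOnWith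
        (s := uIcc 0 t)).absolutelyContinuousOnInterval.integral_deriv_eq_sub
      have h2 : ∫ s in (0:ℝ)..t, deriv (c i) s = ∫ s in (0:ℝ)..t, ⟪e i, v s⟫ := by
        refine intervalIntegral.integral_congr_ae ?_
        filter_upwards [hcdiff] with s hs _ using (hvinner s hs i).symm
      have h3 := (innerSL ℝ (e i)).intervalIntegral_comp_comm (hvint 0 t)
      simp only [innerSL_apply_apply] at h3
      rw [inner_add_right, ← h3, ← h2, h1]
      simp [hcdef]
    refine e.repr.injective ?_
    ext i
    rw [e.repr_apply_apply, e.repr_apply_apply]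
    exact hcoord i
  filter_upwards [_root_.LocallyIntegrable.ae_hasDerivAt_integral hvloc] with t ht
  rw [hrepr]
  exact ((ht 0).const_add (f 0)).differentiableAt

/-- A curve that is Lipschitz on every `[0, T]` is differentiable at a.e. `t > 0`. -/
theorem ae_differentiableAt_of_locallyLipschitz {f : ℝ → H}
    (hf : ∀ T : ℝ, ∃ L : ℝ≥0, LipschitzOnWith L f (Icc 0 T)) :
    ∀ᵐ t, 0 < t → DifferentiableAt ℝ f t := by
  have hn : ∀ n : ℕ, ∀ᵐ t : ℝ, t ∈ Ioo (0:ℝ) n → DifferentiableAt ℝ f t := by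
    intro n
    obtain ⟨L, hL⟩ := hf n
    have hmaps : ∀ t : ℝ, (projIcc (0:ℝ) n n.cast_nonneg t : ℝ) ∈ Icc (0:ℝ) n :=
      fun t => (projIcc (0:ℝ) n n.cast_nonneg t).2
    have hLip : LipschitzWith L (fun t : ℝ => f (projIcc (0:ℝ) n n.cast_nonneg t)) := by
      have h := (hL.to_restrict).comp (LipschitzWith.projIcc (n.cast_nonneg (α := ℝ)))
      rwa [mul_one] at h
    filter_upwards [hLip.ae_differentiableAt_hilbert] with t ht htm
    refine ht.congr_of_eventuallyEq ?_
    filter_upwards [isOpen_Ioo.mem_nhds htm] with s hs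
    rw [projIcc_of_mem n.cast_nonneg (Ioo_subset_Icc_self hs)]
  filter_upwards [ae_all_iff.2 hn] with t ht ht0
  obtain ⟨n, hn⟩ := exists_nat_gt t
  exact ht n ⟨ht0, hn⟩

end Rademacher

section GlobalODE

variable {E : Type*} [NormedAddCommGroup E] [NormedSpace ℝ E]

lemma norm_integral_le_of_norm_le_exp {g : ℝ → E} {B k : ℝ} (hk : 0 < k)
    (hg : ∀ s, ‖g s‖ ≤ B * Real.exp (k * |s|)) (t : ℝ) :
    ‖∫ s in (0:ℝ)..t, g s‖ ≤ B / k * Real.exp (k * |t|) := by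
  wlog ht : 0 ≤ t generalizing g t
  · have h := this (g := fun s => g (-s)) (fun s => by simpa using hg (-s)) (-t) (by linarith)
    rw [intervalIntegral.integral_comp_neg, neg_zero, neg_neg, abs_neg,
      intervalIntegral.integral_symm, norm_neg] at h
    exact h
  have hB : 0 ≤ B := by
    have := (norm_nonneg _).trans (hg 0)
    simpa using this
  have hint : ∫ s in (0:ℝ)..t, B * Real.exp (k * s) = B / k * (Real.exp (k * t) - 1) := by
    rw [intervalIntegral.integral_const_mul, intervalIntegral.integral_comp_mul_left _ hk.ne',
      integral_exp]
    simp
    ring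
  have h1 := intervalIntegral.norm_integral_le_of_norm_le (f := g)
    (g := fun s => B * Real.exp (k * s)) (μ := volume) ht
    (Eventually.of_forall fun s hs => by
      have := hg s
      rwa [abs_of_pos hs.1] at this)
    (Continuous.intervalIntegrable (by fun_prop) _ _)
  rw [hint] at h1
  rw [abs_of_nonneg ht]
  have : 0 ≤ B / k := by positivity
  linarith

variable [CompleteSpace E]

/-- Global existence for autonomous ODEs with a globally Lipschitz vector field. -/
theorem LipschitzWith.exists_forall_hasDerivAt {G : E → E} {Λ : ℝ≥0} (hG : LipschitzWith Λ G)
    (x₀ : E) : ∃ x : ℝ → E, x 0 = x₀ ∧ ∀ t, HasDerivAt x (G (x t)) t := by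
  set k : ℝ := 2 * (Λ + 1) with hk
  have hΛ : (0 : ℝ) ≤ Λ := Λ.coe_nonneg
  have hkpos : 0 < k := by positivity
  let w : BoundedContinuousFunction ℝ E → ℝ → E := fun u s => Real.exp (k * |s|) • u s
  have hwc : ∀ u, Continuous (w u) := fun u => by
    have := u.continuous
    fun_prop
  have hGc : ∀ u, Continuous fun s => G (w u s) := fun u => hG.continuous.comp (hwc u)
  have hGb : ∀ u s, ‖G (w u s)‖ ≤ (‖G 0‖ + Λ * ‖u‖) * Real.exp (k * |s|) := by
    intro u s
    have h1 : ‖G (w u s) - G 0‖ ≤ Λ * ‖w u s‖ := by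
      simpa [dist_eq_norm] using hG.dist_le_mul (w u s) 0
    have h2 : ‖w u s‖ ≤ Real.exp (k * |s|) * ‖u‖ := by
      rw [norm_smul, Real.norm_of_nonneg (Real.exp_pos _).le]
      exact mul_le_mul_of_nonneg_left (u.norm_coe_le_norm s) (Real.exp_pos _).le
    have h3 : 1 ≤ Real.exp (k * |s|) := Real.one_le_exp (by positivity)
    have h4 : ‖G (w u s)‖ ≤ ‖G (w u s) - G 0‖ + ‖G 0‖ := by
      simpa using norm_add_le (G (w u s) - G 0) (G 0)
    nlinarith [norm_nonneg (G 0), mul_le_mul_of_nonneg_left h2 hΛ]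
  have hexp : ∀ t : ℝ, Real.exp (-(k * |t|)) * Real.exp (k * |t|) = 1 := fun t => by
    rw [← Real.exp_add]; simp
  have hΦc : ∀ u, Continuous fun t : ℝ =>
      Real.exp (-(k * |t|)) • (x₀ + ∫ s in (0:ℝ)..t, G (w u s)) := by
    intro u
    have : Continuous fun t : ℝ => ∫ s in (0:ℝ)..t, G (w u s) :=
      intervalIntegral.continuous_primitive (fun a b => (hGc u).intervalIntegrable a b) 0
    fun_prop
  let Φ : BoundedContinuousFunction ℝ E → BoundedContinuousFunction ℝ E := fun u =>
    BoundedContinuousFunction.ofNormedAddCommGroup _ (hΦc u)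
      (‖x₀‖ + (‖G 0‖ + Λ * ‖u‖) / k) (by
        intro t
        rw [norm_smul, Real.norm_of_nonneg (Real.exp_pos _).le]
        have h1 := norm_integral_le_of_norm_le_exp hkpos (hGb u) t
        have h2 := norm_add_le x₀ (∫ s in (0:ℝ)..t, G (w u s))
        have h3 : Real.exp (-(k * |t|)) ≤ 1 := Real.exp_le_one_iff.2 (by
          have := mul_nonneg hkpos.le (abs_nonneg t); linarith)
        have h4 := Real.exp_pos (-(k * |t|))
        calc _ ≤ Real.exp (-(k * |t|)) *
              (‖x₀‖ + (‖G 0‖ + Λ * ‖u‖) / k * Real.exp (k * |t|)) :=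
              mul_le_mul_of_nonneg_left (by linarith) h4.le
          _ = Real.exp (-(k * |t|)) * ‖x₀‖ +
              (‖G 0‖ + Λ * ‖u‖) / k * (Real.exp (-(k * |t|)) * Real.exp (k * |t|)) := by ring
          _ ≤ _ := by
            rw [hexp]
            nlinarith [norm_nonneg x₀])
  have hΦ : ContractingWith (1 / 2) Φ := by
    refine ⟨by rw [← NNReal.coe_lt_coe]; norm_num, LipschitzWith.of_dist_le_mul fun u v => ?_⟩
    refine (BoundedContinuousFunction.dist_le (by positivity)).2 fun t => ?_
    have hd : ∀ s, ‖G (w u s) - G (w v s)‖ ≤ Λ * dist u v * Real.exp (k * |s|) := by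
      intro s
      rw [← dist_eq_norm]
      refine (hG.dist_le_mul _ _).trans ?_
      rw [dist_eq_norm, ← smul_sub, norm_smul, Real.norm_of_nonneg (Real.exp_pos _).le,
        ← dist_eq_norm, mul_assoc (Λ : ℝ), mul_comm (dist u v)]
      exact mul_le_mul_of_nonneg_left (mul_le_mul_of_nonneg_left
        (BoundedContinuousFunction.dist_coe_le_dist s) (Real.exp_pos _).le) hΛ
    have h1 := norm_integral_le_of_norm_le_exp hkpos hd t
    rw [intervalIntegral.integral_sub ((hGc u).intervalIntegrable _ _)
      ((hGc v).intervalIntegrable _ _)] at h1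
    change dist (Real.exp (-(k * |t|)) • (x₀ + ∫ s in (0:ℝ)..t, G (w u s)))
      (Real.exp (-(k * |t|)) • (x₀ + ∫ s in (0:ℝ)..t, G (w v s))) ≤ _
    rw [dist_eq_norm, ← smul_sub, norm_smul, Real.norm_of_nonneg (Real.exp_pos _).le,
      add_sub_add_left_eq_sub]
    calc _ ≤ Real.exp (-(k * |t|)) * (Λ * dist u v / k * Real.exp (k * |t|)) :=
          mul_le_mul_of_nonneg_left h1 (Real.exp_pos _).le
      _ = Λ / k * dist u v * (Real.exp (-(k * |t|)) * Real.exp (k * |t|)) := by ring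
      _ ≤ _ := by
        rw [hexp, mul_one]
        refine mul_le_mul_of_nonneg_right ?_ dist_nonneg
        rw [div_le_iff₀ hkpos, hk]
        push_cast
        linarith
  set u := hΦ.fixedPoint Φ
  have hu : ∀ t, w u t = x₀ + ∫ s in (0:ℝ)..t, G (w u s) := by
    intro t
    have h := DFunLike.congr_fun hΦ.fixedPoint_isFixedPt t
    change Real.exp (-(k * |t|)) • (x₀ + ∫ s in (0:ℝ)..t, G (w u s)) = u t at h
    change Real.exp (k * |t|) • u t = _
    rw [← h, smul_smul, mul_comm, hexp, one_smul]
  refine ⟨w u, by rw [hu]; simp, fun t => ?_⟩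
  have hder := intervalIntegral.integral_hasDerivAt_right ((hGc u).intervalIntegrable 0 t)
    ((hGc u).stronglyMeasurableAtFilter _ _) (hGc u).continuousAt
  exact (hder.const_add x₀).congr_of_eventuallyEq (Eventually.of_forall hu)

end GlobalODE

section Projection

variable {H : Type*} [NormedAddCommGroup H] [InnerProductSpace ℝ H] {K : Set H} {P : H → H}

/-- `P` is the metric projection onto the convex set `K`, in variational form. -/
structure IsMetricProj (K : Set H) (P : H → H) : Prop where
  mem : ∀ x, P x ∈ K
  inner_le : ∀ x, ∀ y ∈ K, ⟪x - P x, y - P x⟫ ≤ 0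

lemma exists_isMetricProj [CompleteSpace H] (hcl : IsClosed K) (hcv : Convex ℝ K)
    (hne : K.Nonempty) : ∃ P : H → H, IsMetricProj K P := by
  choose P hPmem hP using exists_norm_eq_iInf_of_complete_convex hne hcl.isComplete hcv
  exact ⟨P, hPmem, fun x => (norm_eq_iInf_iff_real_inner_le_zero hcv (hPmem x)).1 (hP x)⟩

namespace IsMetricProj

lemma eq_self (hP : IsMetricProj K P) {x : H} (hx : x ∈ K) : P x = x := by
  have h := hP.inner_le x x hx
  rw [real_inner_self_nonpos, sub_eq_zero] at h
  exact h.symm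

lemma norm_sub_sq_le (hP : IsMetricProj K P) (x y : H) :
    ‖P x - P y‖ ^ 2 ≤ ⟪x - y, P x - P y⟫ := by
  have h1 := hP.inner_le x (P y) (hP.mem y)
  have h2 := hP.inner_le y (P x) (hP.mem x)
  rw [← real_inner_self_eq_norm_sq]
  simp only [inner_sub_left, inner_sub_right] at *
  linarith

lemma lipschitzWith (hP : IsMetricProj K P) : LipschitzWith 1 P := by
  refine LipschitzWith.of_dist_le_mul fun x y => ?_
  rw [dist_eq_norm, dist_eq_norm, NNReal.coe_one, one_mul]
  have h1 := hP.norm_sub_sq_le x y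
  have h2 := real_inner_le_norm (x - y) (P x - P y)
  by_contra! h
  nlinarith [norm_nonneg (x - y)]

lemma inner_residual_sub_nonneg (hP : IsMetricProj K P) (x y : H) :
    0 ≤ ⟪(x - P x) - (y - P y), x - y⟫ := by
  have h1 := hP.lipschitzWith.dist_le_mul x y
  rw [dist_eq_norm, dist_eq_norm, NNReal.coe_one, one_mul] at h1
  have h2 := real_inner_le_norm (P x - P y) (x - y)
  have h3 : ⟪(x - P x) - (y - P y), x - y⟫ = ‖x - y‖ ^ 2 - ⟪P x - P y, x - y⟫ := by
    rw [← real_inner_self_eq_norm_sq, ← inner_sub_left]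
    congr 1
    abel
  rw [h3]
  nlinarith [norm_nonneg (x - y)]

lemma inner_residual_nonneg (hP : IsMetricProj K P) (x : H) {z : H} (hz : z ∈ K) :
    0 ≤ ⟪x - P x, x - z⟫ := by
  have h1 := hP.inner_le x z hz
  have h2 : ⟪x - P x, x - z⟫ = ‖x - P x‖ ^ 2 - ⟪x - P x, z - P x⟫ := by
    rw [← real_inner_self_eq_norm_sq, ← inner_sub_right]
    congr 1
    abel
  rw [h2]
  nlinarith [sq_nonneg ‖x - P x‖]

/-- Almost-monotonicity between two Yosida approximations of the normal cone. -/
lemma inner_yosida_sub_ge (hP : IsMetricProj K P) {c₁ c₂ M : ℝ} (hc₁ : 0 < c₁) (hc₂ : 0 < c₂)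
    {x y : H} (hx : ‖c₁ • (x - P x)‖ ≤ M) (hy : ‖c₂ • (y - P y)‖ ≤ M) :
    -(M ^ 2 * (1 / c₁ + 1 / c₂)) ≤ ⟪c₁ • (x - P x) - c₂ • (y - P y), x - y⟫ := by
  have h1 := mul_nonpos_of_nonneg_of_nonpos hc₁.le (hP.inner_le x (P y) (hP.mem y))
  have h2 := mul_nonpos_of_nonneg_of_nonpos hc₂.le (hP.inner_le y (P x) (hP.mem x))
  set w₁ := c₁ • (x - P x) with hw₁
  set w₂ := c₂ • (y - P y) with hw₂
  rw [← real_inner_smul_left, ← hw₁] at h1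
  rw [← real_inner_smul_left, ← hw₂] at h2
  have hr₁ : x - P x = (1 / c₁) • w₁ := by rw [hw₁, smul_smul, one_div_mul_cancel hc₁.ne', one_smul]
  have hr₂ : y - P y = (1 / c₂) • w₂ := by rw [hw₂, smul_smul, one_div_mul_cancel hc₂.ne', one_smul]
  have hsplit : x - y = (P x - P y) + ((1 / c₁) • w₁ - (1 / c₂) • w₂) := by
    rw [← hr₁, ← hr₂]; abel
  have hcs := (real_inner_le_norm w₁ w₂).trans
    (mul_le_mul hx hy (norm_nonneg _) ((norm_nonneg _).trans hx))
  rw [hsplit]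
  have e1 := real_inner_self_eq_norm_sq w₁
  have e2 := real_inner_self_eq_norm_sq w₂
  have p1 : 0 < 1 / c₁ := by positivity
  have p2 : 0 < 1 / c₂ := by positivity
  simp only [inner_sub_left, inner_sub_right, inner_add_right, inner_smul_right,
    real_inner_comm w₁ w₂, e1, e2] at *
  nlinarith [mul_le_mul_of_nonneg_left hcs p1.le, mul_le_mul_of_nonneg_left hcs p2.le,
    mul_nonneg p1.le (sq_nonneg ‖w₁‖), mul_nonneg p2.le (sq_nonneg ‖w₂‖)]

end IsMetricProj

end Projection

section Energy

variable {H : Type*} [NormedAddCommGroup H] [InnerProductSpace ℝ H]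

lemma energy_deriv_le {L δ : ℝ} (hL : 0 ≤ L) {x y w g : H} (hg : ‖g‖ ≤ L * ‖x‖)
    (hw : -δ ≤ ⟪w, x⟫) :
    2 * ⟪x, y - w⟫ + 2 * ⟪y, g⟫ ≤ (1 + L) * (‖x‖ ^ 2 + ‖y‖ ^ 2) + 2 * δ := by
  have h1 := real_inner_le_norm x y
  have h2 := (real_inner_le_norm y g).trans (mul_le_mul_of_nonneg_left hg (norm_nonneg y))
  rw [inner_sub_right, real_inner_comm w x]
  nlinarith [mul_nonneg hL (sq_nonneg (‖x‖ - ‖y‖)), sq_nonneg (‖x‖ - ‖y‖)]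

/-- Stability estimate for two trajectories of `X' = Y - w`, `Y' = g`. -/
lemma energy_le {X₁ X₂ Y₁ Y₂ w₁ w₂ g₁ g₂ : ℝ → H} {L δ T : ℝ} (hL : 0 ≤ L) (hδ : 0 ≤ δ)
    (hT : 0 ≤ T)
    (hX₁ : ∀ t, HasDerivAt X₁ (Y₁ t - w₁ t) t) (hX₂ : ∀ t, HasDerivAt X₂ (Y₂ t - w₂ t) t)
    (hY₁ : ∀ t, HasDerivAt Y₁ (g₁ t) t) (hY₂ : ∀ t, HasDerivAt Y₂ (g₂ t) t)
    (hw₁ : Continuous w₁) (hw₂ : Continuous w₂) (hg₁ : Continuous g₁) (hg₂ : Continuous g₂)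
    (hg : ∀ t, ‖g₁ t - g₂ t‖ ≤ L * ‖X₁ t - X₂ t‖)
    (hw : ∀ t ∈ Ioo 0 T, -δ ≤ ⟪w₁ t - w₂ t, X₁ t - X₂ t⟫) :
    ‖X₁ T - X₂ T‖ ^ 2 + ‖Y₁ T - Y₂ T‖ ^ 2 ≤
      Real.exp ((1 + L) * T) * (‖X₁ 0 - X₂ 0‖ ^ 2 + ‖Y₁ 0 - Y₂ 0‖ ^ 2 + 2 * δ * T) := by
  have hXc₁ : Continuous X₁ := continuous_iff_continuousAt.2 fun t => (hX₁ t).continuousAt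
  have hXc₂ : Continuous X₂ := continuous_iff_continuousAt.2 fun t => (hX₂ t).continuousAt
  have hYc₁ : Continuous Y₁ := continuous_iff_continuousAt.2 fun t => (hY₁ t).continuousAt
  have hYc₂ : Continuous Y₂ := continuous_iff_continuousAt.2 fun t => (hY₂ t).continuousAt
  refine le_exp_mul_of_hasDerivAt_le (q := fun t => ‖X₁ t - X₂ t‖ ^ 2 + ‖Y₁ t - Y₂ t‖ ^ 2)
    (d := fun t => 2 * ⟪X₁ t - X₂ t, (Y₁ t - w₁ t) - (Y₂ t - w₂ t)⟫ +
      2 * ⟪Y₁ t - Y₂ t, g₁ t - g₂ t⟫) (by linarith) (by linarith) hT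
    (fun t => (((hX₁ t).sub (hX₂ t)).norm_sq).add (((hY₁ t).sub (hY₂ t)).norm_sq))
    (by fun_prop) fun t ht => ?_
  rw [sub_sub_sub_comm]
  exact energy_deriv_le hL (hg t) (hw t ht)

end Energy

section Penalization

variable {H : Type*} [NormedAddCommGroup H] [InnerProductSpace ℝ H] {K : Set H} {P F : H → H}

/-- The penalized system `X' = Y - c (X - P X)`, `Y' = F (P X)`. -/
structure IsPenalizedSol (F P : H → H) (c : ℝ) (x v : H) (X Y : ℝ → H) : Prop where
  init_fst : X 0 = x
  init_snd : Y 0 = v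
  deriv_fst : ∀ t, HasDerivAt X (Y t - c • (X t - P (X t))) t
  deriv_snd : ∀ t, HasDerivAt Y (F (P (X t))) t

lemma LipschitzOnWith.comp_isMetricProj {L : ℝ≥0} (hF : LipschitzOnWith L F K)
    (hP : IsMetricProj K P) : LipschitzWith L (fun x => F (P x)) := by
  refine LipschitzWith.of_dist_le_mul fun x y => ?_
  refine (hF.dist_le_mul _ (hP.mem x) _ (hP.mem y)).trans ?_
  exact mul_le_mul_of_nonneg_left (by simpa using hP.lipschitzWith.dist_le_mul x y) L.coe_nonneg

lemma exists_isPenalizedSol [CompleteSpace H] {L : ℝ≥0} (hF : LipschitzOnWith L F K)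
    (hP : IsMetricProj K P) (c : ℝ) (x v : H) : ∃ X Y, IsPenalizedSol F P c x v X Y := by
  have h1 : LipschitzWith 1 (Prod.fst : H × H → H) := LipschitzWith.prod_fst
  have h2 : LipschitzWith 1 (Prod.snd : H × H → H) := LipschitzWith.prod_snd
  obtain ⟨z, hz0, hz⟩ := ((h2.sub ((lipschitzWith_smul c).comp
    (h1.sub (hP.lipschitzWith.comp h1)))).prodMk
      ((hF.comp_isMetricProj hP).comp h1)).exists_forall_hasDerivAt (x, v)
  exact ⟨fun t => (z t).1, fun t => (z t).2, by simp [hz0], by simp [hz0],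
    fun t => (hz t).fst, fun t => (hz t).snd⟩

namespace IsPenalizedSol

variable {c : ℝ} {x v : H} {X Y : ℝ → H}

lemma continuous_fst (h : IsPenalizedSol F P c x v X Y) : Continuous X :=
  continuous_iff_continuousAt.2 fun t => (h.deriv_fst t).continuousAt

lemma continuous_snd (h : IsPenalizedSol F P c x v X Y) : Continuous Y :=
  continuous_iff_continuousAt.2 fun t => (h.deriv_snd t).continuousAt

lemma continuous_force {L : ℝ≥0} (hF : LipschitzOnWith L F K) (hP : IsMetricProj K P)
    (h : IsPenalizedSol F P c x v X Y) : Continuous fun t => F (P (X t)) :=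
  (hF.comp_isMetricProj hP).continuous.comp h.continuous_fst

lemma continuous_penalty (hP : IsMetricProj K P) (h : IsPenalizedSol F P c x v X Y) :
    Continuous fun t => c • (X t - P (X t)) := by
  have h1 := h.continuous_fst
  have h2 := hP.lipschitzWith.continuous
  fun_prop

/-- The velocities of the penalized system are bounded uniformly in the penalization. -/
lemma deriv_sq_le {L : ℝ≥0} (hF : LipschitzOnWith L F K) (hP : IsMetricProj K P) (hc : 0 ≤ c)
    (hx : x ∈ K) (h : IsPenalizedSol F P c x v X Y) {t : ℝ} (ht : 0 ≤ t) :
    ‖Y t - c • (X t - P (X t))‖ ^ 2 + ‖F (P (X t))‖ ^ 2 ≤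
      Real.exp ((1 + L) * t) * (‖v‖ ^ 2 + ‖F x‖ ^ 2) := by
  have hshift : ∀ s : ℝ, ‖X (t + s) - X t‖ ^ 2 + ‖Y (t + s) - Y t‖ ^ 2 ≤
      Real.exp ((1 + L) * t) * (‖X (0 + s) - X 0‖ ^ 2 + ‖Y (0 + s) - Y 0‖ ^ 2) := by
    intro s
    have hs : Continuous fun t : ℝ => t + s := by fun_prop
    have := energy_le (X₁ := fun t => X (t + s)) (X₂ := X) (Y₁ := fun t => Y (t + s)) (Y₂ := Y)
      (δ := 0) L.coe_nonneg le_rfl ht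
      (fun t => (h.deriv_fst (t + s)).comp_add_const t s) h.deriv_fst
      (fun t => (h.deriv_snd (t + s)).comp_add_const t s) h.deriv_snd
      ((h.continuous_penalty hP).comp hs) (h.continuous_penalty hP)
      ((h.continuous_force hF hP).comp hs) (h.continuous_force hF hP)
      (fun t => by
        simpa [dist_eq_norm] using (hF.comp_isMetricProj hP).dist_le_mul (X (t + s)) (X t))
      (fun t _ => by
        rw [← smul_sub, real_inner_smul_left, neg_zero]
        exact mul_nonneg hc (hP.inner_residual_sub_nonneg _ _))
    simpa using this
  have hslope : ∀ (t s : ℝ), ‖s⁻¹ • (X (t + s) - X t)‖ ^ 2 + ‖s⁻¹ • (Y (t + s) - Y t)‖ ^ 2 =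
      (‖s⁻¹‖ ^ 2) * (‖X (t + s) - X t‖ ^ 2 + ‖Y (t + s) - Y t‖ ^ 2) := by
    intro t s
    rw [norm_smul, norm_smul]; ring
  have hlim : ∀ t, Tendsto
      (fun s : ℝ => ‖s⁻¹ • (X (t + s) - X t)‖ ^ 2 + ‖s⁻¹ • (Y (t + s) - Y t)‖ ^ 2) (𝓝[≠] 0)
      (𝓝 (‖Y t - c • (X t - P (X t))‖ ^ 2 + ‖F (P (X t))‖ ^ 2)) := fun t =>
    ((hasDerivAt_iff_tendsto_slope_zero.1 (h.deriv_fst t)).norm.pow 2).add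
      ((hasDerivAt_iff_tendsto_slope_zero.1 (h.deriv_snd t)).norm.pow 2)
  have h0 := (hlim 0).const_mul (Real.exp ((1 + L) * t))
  rw [h.init_fst, h.init_snd, hP.eq_self hx, sub_self, smul_zero, sub_zero, ← h.init_fst,
    ← h.init_snd] at h0
  rw [← h.init_fst, ← h.init_snd]
  refine le_of_tendsto_of_tendsto' (hlim t) h0 fun s => ?_
  rw [hslope, hslope, mul_left_comm]
  exact mul_le_mul_of_nonneg_left (hshift s) (by positivity)

end IsPenalizedSol

end Penalization

section Existence

variable {H : Type*} [NormedAddCommGroup H] [InnerProductSpace ℝ H] {K : Set H} {P F : H → H}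

namespace IsPenalizedSol

variable {c : ℝ} {x v : H} {X Y : ℝ → H}

lemma norm_sub_le {L : ℝ≥0} (hF : LipschitzOnWith L F K) (hP : IsMetricProj K P) (hc : 0 ≤ c)
    (hx : x ∈ K) (h : IsPenalizedSol F P c x v X Y) {T M : ℝ} (hM0 : 0 ≤ M)
    (hM : Real.exp ((1 + L) * T) * (‖v‖ ^ 2 + ‖F x‖ ^ 2) ≤ M ^ 2) :
    (∀ t ∈ Icc 0 T, ‖Y t - c • (X t - P (X t))‖ ≤ M) ∧
    (∀ s ∈ Icc 0 T, ∀ t ∈ Icc 0 T, ‖X t - X s‖ ≤ M * ‖t - s‖) ∧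
    (∀ s ∈ Icc 0 T, ∀ t ∈ Icc 0 T, ‖Y t - Y s‖ ≤ M * ‖t - s‖) := by
  have key : ∀ t ∈ Icc 0 T, ‖Y t - c • (X t - P (X t))‖ ^ 2 + ‖F (P (X t))‖ ^ 2 ≤ M ^ 2 := by
    intro t ht
    refine (h.deriv_sq_le hF hP hc hx ht.1).trans (le_trans ?_ hM)
    refine mul_le_mul_of_nonneg_right (Real.exp_le_exp.2 ?_) (by positivity)
    exact mul_le_mul_of_nonneg_left ht.2 (by positivity)
  have hX : ∀ t ∈ Icc 0 T, ‖Y t - c • (X t - P (X t))‖ ≤ M := fun t ht =>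
    le_of_sq_le_sq (by nlinarith [key t ht, sq_nonneg ‖F (P (X t))‖]) hM0
  have hY : ∀ t ∈ Icc 0 T, ‖F (P (X t))‖ ≤ M := fun t ht =>
    le_of_sq_le_sq (by nlinarith [key t ht, sq_nonneg ‖Y t - c • (X t - P (X t))‖]) hM0
  exact ⟨hX, fun s hs t ht => (convex_Icc 0 T).norm_image_sub_le_of_norm_hasDerivWithin_le
      (fun r _ => (h.deriv_fst r).hasDerivWithinAt) hX hs ht,
    fun s hs t ht => (convex_Icc 0 T).norm_image_sub_le_of_norm_hasDerivWithin_le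
      (fun r _ => (h.deriv_snd r).hasDerivWithinAt) hY hs ht⟩

/-- Comparison of two penalized solutions with different penalization parameters. -/
lemma gap_le {L : ℝ≥0} (hF : LipschitzOnWith L F K) (hP : IsMetricProj K P) {c₁ c₂ T N : ℝ}
    (hc₁ : 0 < c₁) (hc₂ : 0 < c₂) (hT : 0 ≤ T) {X₁ X₂ Y₁ Y₂ : ℝ → H}
    (h₁ : IsPenalizedSol F P c₁ x v X₁ Y₁) (h₂ : IsPenalizedSol F P c₂ x v X₂ Y₂)
    (hN₁ : ∀ t ∈ Icc 0 T, ‖c₁ • (X₁ t - P (X₁ t))‖ ≤ N)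
    (hN₂ : ∀ t ∈ Icc 0 T, ‖c₂ • (X₂ t - P (X₂ t))‖ ≤ N) :
    ‖X₁ T - X₂ T‖ ^ 2 + ‖Y₁ T - Y₂ T‖ ^ 2 ≤
      Real.exp ((1 + L) * T) * (2 * (N ^ 2 * (1 / c₁ + 1 / c₂)) * T) := by
  have := energy_le (δ := N ^ 2 * (1 / c₁ + 1 / c₂)) L.coe_nonneg (by positivity) hT
    h₁.deriv_fst h₂.deriv_fst h₁.deriv_snd h₂.deriv_snd (h₁.continuous_penalty hP)
    (h₂.continuous_penalty hP) (h₁.continuous_force hF hP) (h₂.continuous_force hF hP)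
    (fun t => by
      simpa [dist_eq_norm] using (hF.comp_isMetricProj hP).dist_le_mul (X₁ t) (X₂ t))
    (fun t ht => hP.inner_yosida_sub_ge hc₁ hc₂ (hN₁ t (Ioo_subset_Icc_self ht))
      (hN₂ t (Ioo_subset_Icc_self ht)))
  simpa [h₁.init_fst, h₂.init_fst, h₁.init_snd, h₂.init_snd] using this

/-- Evolution variational inequality along the penalized flow. -/
lemma norm_sub_sq_sub_le (hP : IsMetricProj K P) (hc : 0 ≤ c)
    (h : IsPenalizedSol F P c x v X Y) {z : H} (hz : z ∈ K) {s t : ℝ} (hst : s ≤ t) :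
    ‖X t - z‖ ^ 2 - ‖X s - z‖ ^ 2 ≤ ∫ r in s..t, 2 * ⟪X r - z, Y r⟫ := by
  have hX := h.continuous_fst
  have hY := h.continuous_snd
  have hw := h.continuous_penalty hP
  have hder : ∀ r, HasDerivAt (fun r => ‖X r - z‖ ^ 2)
      (2 * ⟪X r - z, Y r - c • (X r - P (X r))⟫) r := fun r =>
    ((h.deriv_fst r).sub_const z).norm_sq
  rw [← intervalIntegral.integral_eq_sub_of_hasDerivAt (fun r _ => hder r)
    (Continuous.intervalIntegrable (by fun_prop) _ _)]
  refine intervalIntegral.integral_mono_on hst (Continuous.intervalIntegrable (by fun_prop) _ _)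
    (Continuous.intervalIntegrable (by fun_prop) _ _) fun r _ => ?_
  rw [inner_sub_right, real_inner_comm (c • _), real_inner_smul_left]
  nlinarith [mul_nonneg hc (hP.inner_residual_nonneg (X r) hz)]

end IsPenalizedSol

/-- A locally Lipschitz curve in `K` with `Y - X' ∈ N_K(X)` a.e., `Y = v + ∫ F(X)`. -/
def IsEvolutionSol (K : Set H) (F : H → H) (x v : H) (X : ℝ → H) : Prop :=
  (∀ t : ℝ, 0 ≤ t → X t ∈ K) ∧ X 0 = x ∧
  (∀ T : ℝ, ∃ L : ℝ≥0, LipschitzOnWith L X (Icc 0 T)) ∧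
  (∀ᵐ t ∂(volume.restrict (Ioi (0 : ℝ))), ∃ V : H, HasDerivAt X V t ∧
    ∀ y ∈ K, ⟪(v + ∫ s in Ioc (0 : ℝ) t, F (X s)) - V, y - X t⟫ ≤ 0)

variable [CompleteSpace H]

lemma exists_penalized_limit {L : ℝ≥0} (hF : LipschitzOnWith L F K) (hP : IsMetricProj K P)
    {x : H} (hx : x ∈ K) (v : H) : ∃ (Xn Yn : ℕ → ℝ → H) (X Y : ℝ → H) (M : ℝ → ℝ),
      (∀ n : ℕ, IsPenalizedSol F P ((n : ℝ) + 1) x v (Xn n) (Yn n)) ∧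
      (∀ t, 0 ≤ t → Tendsto (fun n => Xn n t) atTop (𝓝 (X t))) ∧
      (∀ t, 0 ≤ t → Tendsto (fun n => Yn n t) atTop (𝓝 (Y t))) ∧
      (∀ t, 0 ≤ t → Tendsto (fun n => P (Xn n t)) atTop (𝓝 (X t))) ∧
      (∀ T, 0 ≤ T → 0 ≤ M T ∧ ∀ n, ∀ s ∈ Icc 0 T, ∀ t ∈ Icc 0 T,
        ‖Xn n t - Xn n s‖ ≤ M T * ‖t - s‖ ∧ ‖Yn n t - Yn n s‖ ≤ M T * ‖t - s‖) := by
  choose Xn Yn hsol using fun n : ℕ => exists_isPenalizedSol hF hP ((n : ℝ) + 1) x v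
  set M : ℝ → ℝ := fun T => √(Real.exp ((1 + L) * T) * (‖v‖ ^ 2 + ‖F x‖ ^ 2)) with hMdef
  have hM0 : ∀ T, 0 ≤ M T := fun T => Real.sqrt_nonneg _
  have hM : ∀ T, Real.exp ((1 + L) * T) * (‖v‖ ^ 2 + ‖F x‖ ^ 2) ≤ M T ^ 2 := fun T => by
    rw [hMdef, Real.sq_sqrt (by positivity)]
  have hb := fun n T => (hsol n).norm_sub_le hF hP (by positivity) hx (hM0 T) (hM T)
  set N : ℝ → ℝ := fun T => ‖v‖ + M T * T + M T
  have hN : ∀ (n : ℕ) (T : ℝ), 0 ≤ T → ∀ t ∈ Icc 0 T,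
      ‖((n : ℝ) + 1) • (Xn n t - P (Xn n t))‖ ≤ N T := by
    intro n T hT t ht
    have h1 := (hb n T).1 t ht
    have h2 := (hb n T).2.2 0 ⟨le_rfl, hT⟩ t ht
    rw [(hsol n).init_snd, sub_zero, Real.norm_of_nonneg ht.1] at h2
    have h3 : ‖Yn n t‖ ≤ ‖Yn n t - v‖ + ‖v‖ := by simpa using norm_add_le (Yn n t - v) v
    have h4 := norm_sub_le (Yn n t) (Yn n t - ((n : ℝ) + 1) • (Xn n t - P (Xn n t)))
    rw [sub_sub_cancel] at h4
    have h5 := mul_le_mul_of_nonneg_left ht.2 (hM0 T)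
    simp only [N]
    linarith
  have hgap : ∀ t, 0 ≤ t → ∃ B, ∀ n m : ℕ, n ≤ m →
      ‖Xn n t - Xn m t‖ ^ 2 + ‖Yn n t - Yn m t‖ ^ 2 ≤ B * (1 / ((n : ℝ) + 1)) := by
    intro t ht
    refine ⟨Real.exp ((1 + L) * t) * (4 * N t ^ 2 * t), fun n m hnm => ?_⟩
    refine ((hsol n).gap_le hF hP (by positivity) (by positivity) ht (hsol m) (hN n t ht)
      (hN m t ht)).trans ?_
    have h1 : 1 / ((m : ℝ) + 1) ≤ 1 / ((n : ℝ) + 1) := Nat.one_div_le_one_div hnm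
    have h2 : 0 ≤ 2 * N t ^ 2 * t := by positivity
    rw [mul_assoc (Real.exp _) (4 * N t ^ 2 * t)]
    refine mul_le_mul_of_nonneg_left ?_ (Real.exp_pos _).le
    nlinarith [mul_le_mul_of_nonneg_left h1 h2]
  have hB0 : ∀ B : ℝ, Tendsto (fun n : ℕ => √(B * (1 / ((n : ℝ) + 1)))) atTop (𝓝 0) := by
    intro B
    have := (tendsto_one_div_add_atTop_nhds_zero_nat (𝕜 := ℝ)).const_mul B
    simpa [Function.comp_def] using (Real.continuous_sqrt.tendsto _).comp this
  have hXlim : ∀ t, ∃ l, 0 ≤ t → Tendsto (fun n => Xn n t) atTop (𝓝 l) := by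
    intro t
    by_cases ht : 0 ≤ t
    · obtain ⟨B, hB⟩ := hgap t ht
      obtain ⟨l, hl⟩ := cauchySeq_tendsto_of_complete (cauchySeq_of_le_tendsto_0' _
        (fun n m hnm => by
          rw [dist_eq_norm]
          exact Real.le_sqrt_of_sq_le
            (by nlinarith [hB n m hnm, sq_nonneg ‖Yn n t - Yn m t‖])) (hB0 B) :
              CauchySeq fun n => Xn n t)
      exact ⟨l, fun _ => hl⟩
    · exact ⟨0, fun h => absurd h ht⟩
  have hYlim : ∀ t, ∃ l, 0 ≤ t → Tendsto (fun n => Yn n t) atTop (𝓝 l) := by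
    intro t
    by_cases ht : 0 ≤ t
    · obtain ⟨B, hB⟩ := hgap t ht
      obtain ⟨l, hl⟩ := cauchySeq_tendsto_of_complete (cauchySeq_of_le_tendsto_0' _
        (fun n m hnm => by
          rw [dist_eq_norm]
          exact Real.le_sqrt_of_sq_le
            (by nlinarith [hB n m hnm, sq_nonneg ‖Xn n t - Xn m t‖])) (hB0 B) :
              CauchySeq fun n => Yn n t)
      exact ⟨l, fun _ => hl⟩
    · exact ⟨0, fun h => absurd h ht⟩
  choose X hX using hXlim
  choose Y hY using hYlim
  refine ⟨Xn, Yn, X, Y, M, hsol, hX, hY, fun t ht => ?_, fun T _ => ⟨hM0 T, fun n s hs t ht =>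
    ⟨(hb n T).2.1 s hs t ht, (hb n T).2.2 s hs t ht⟩⟩⟩
  have hres : Tendsto (fun n => Xn n t - P (Xn n t)) atTop (𝓝 0) := by
    refine squeeze_zero_norm (a := fun n : ℕ => N t * (1 / ((n : ℝ) + 1))) (fun n => ?_) ?_
    · have h1 := hN n t ht t ⟨ht, le_rfl⟩
      rw [norm_smul, Real.norm_of_nonneg (by positivity)] at h1
      rw [mul_one_div, le_div_iff₀ (by positivity), mul_comm]
      exact h1
    · simpa using (tendsto_one_div_add_atTop_nhds_zero_nat (𝕜 := ℝ)).const_mul (N t)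
  simpa using (hX t ht).sub hres

/-- Existence of evolution solutions for a closed convex constraint set. -/
theorem exists_isEvolutionSol [TopologicalSpace.SeparableSpace H] (hcl : IsClosed K)
    (hcv : Convex ℝ K) {L : ℝ≥0} (hF : LipschitzOnWith L F K) {x : H} (hx : x ∈ K) (v : H) :
    ∃ X, IsEvolutionSol K F x v X := by
  obtain ⟨P, hP⟩ := exists_isMetricProj hcl hcv ⟨x, hx⟩
  obtain ⟨Xn, Yn, X, Y, M, hsol, hX, hY, hPX, hM⟩ := exists_penalized_limit hF hP hx v
  have hXK : ∀ t, 0 ≤ t → X t ∈ K := fun t ht =>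
    hcl.mem_of_tendsto (hPX t ht) (Eventually.of_forall fun n => hP.mem _)
  have hX0 : X 0 = x := tendsto_nhds_unique (hX 0 le_rfl) (by simp [(hsol _).init_fst])
  have hLip : ∀ T, 0 ≤ T → ∀ s ∈ Icc 0 T, ∀ t ∈ Icc 0 T,
      ‖X t - X s‖ ≤ M T * ‖t - s‖ ∧ ‖Y t - Y s‖ ≤ M T * ‖t - s‖ := by
    intro T hT s hs t ht
    exact ⟨le_of_tendsto' ((hX t ht.1).sub (hX s hs.1)).norm fun n => ((hM T hT).2 n s hs t ht).1,
      le_of_tendsto' ((hY t ht.1).sub (hY s hs.1)).norm fun n => ((hM T hT).2 n s hs t ht).2⟩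
  have hLipOn : ∀ {Z : ℝ → H}, (∀ T, 0 ≤ T → ∀ s ∈ Icc 0 T, ∀ t ∈ Icc 0 T,
      ‖Z t - Z s‖ ≤ M T * ‖t - s‖) → ∀ T, ∃ L : ℝ≥0, LipschitzOnWith L Z (Icc 0 T) := by
    intro Z hZ T
    rcases lt_or_ge T 0 with hT | hT
    · exact ⟨0, by simp [Icc_eq_empty hT.not_ge]⟩
    · refine ⟨(M T).toNNReal, LipschitzOnWith.of_dist_le_mul fun s hs t ht => ?_⟩
      rw [dist_eq_norm, dist_eq_norm, Real.coe_toNNReal _ (hM T hT).1]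
      exact hZ T hT t ht s hs
  have hXLip := hLipOn fun T hT s hs t ht => (hLip T hT s hs t ht).1
  have hYLip := hLipOn fun T hT s hs t ht => (hLip T hT s hs t ht).2
  have hbound : ∀ T, 0 ≤ T → ∀ n, ∀ t ∈ Icc 0 T,
      ‖Xn n t‖ ≤ ‖x‖ + M T * T ∧ ‖Yn n t‖ ≤ ‖v‖ + M T * T := by
    intro T hT n t ht
    obtain ⟨h1, h2⟩ := (hM T hT).2 n 0 ⟨le_rfl, hT⟩ t ht
    rw [(hsol n).init_fst, sub_zero, Real.norm_of_nonneg ht.1] at h1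
    rw [(hsol n).init_snd, sub_zero, Real.norm_of_nonneg ht.1] at h2
    have h3 : ‖Xn n t‖ ≤ ‖Xn n t - x‖ + ‖x‖ := by simpa using norm_add_le (Xn n t - x) x
    have h4 : ‖Yn n t‖ ≤ ‖Yn n t - v‖ + ‖v‖ := by simpa using norm_add_le (Yn n t - v) v
    have h5 := mul_le_mul_of_nonneg_left ht.2 (hM T hT).1
    constructor <;> linarith
  have hYint : ∀ t, 0 ≤ t → Y t = v + ∫ s in Ioc (0 : ℝ) t, F (X s) := by
    intro t ht
    have hFP := hF.comp_isMetricProj hP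
    have hlim : Tendsto (fun n => ∫ s in (0:ℝ)..t, F (P (Xn n s))) atTop
        (𝓝 (∫ s in (0:ℝ)..t, F (X s))) := by
      refine intervalIntegral.tendsto_integral_filter_of_dominated_convergence
        (fun _ => ‖F (P 0)‖ + L * (‖x‖ + M t * t)) ?_ ?_ (by simp) ?_
      · exact Eventually.of_forall fun n =>
          ((hsol n).continuous_force hF hP).aestronglyMeasurable
      · refine Eventually.of_forall fun n => Eventually.of_forall fun s hs => ?_
        rw [uIoc_of_le ht] at hs
        have h1 : ‖F (P (Xn n s)) - F (P 0)‖ ≤ L * ‖Xn n s‖ := by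
          simpa [dist_eq_norm] using hFP.dist_le_mul (Xn n s) 0
        have h2 := mul_le_mul_of_nonneg_left (hbound t ht n s (Ioc_subset_Icc_self hs)).1
          L.coe_nonneg
        have h3 : ‖F (P (Xn n s))‖ ≤ ‖F (P (Xn n s)) - F (P 0)‖ + ‖F (P 0)‖ := by
          simpa using norm_add_le (F (P (Xn n s)) - F (P 0)) (F (P 0))
        linarith
      · refine Eventually.of_forall fun s hs => ?_
        rw [uIoc_of_le ht] at hs
        have := (hFP.continuous.tendsto _).comp (hX s hs.1.le)
        rwa [hP.eq_self (hXK s hs.1.le)] at this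
    have hYn : ∀ n, Yn n t = v + ∫ s in (0:ℝ)..t, F (P (Xn n s)) := by
      intro n
      rw [intervalIntegral.integral_eq_sub_of_hasDerivAt (fun s _ => (hsol n).deriv_snd s)
        (((hsol n).continuous_force hF hP).intervalIntegrable _ _), (hsol n).init_snd]
      abel
    rw [← intervalIntegral.integral_of_le ht]
    refine tendsto_nhds_unique (hY t ht) ?_
    simp only [hYn]
    exact hlim.const_add v
  have hcont : ∀ {Z : ℝ → H}, (∀ T, ∃ L : ℝ≥0, LipschitzOnWith L Z (Icc 0 T)) →
      ∀ t, 0 < t → ContinuousAt Z t := by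
    intro Z hZ t ht
    obtain ⟨L, hL⟩ := hZ (t + 1)
    exact hL.continuousOn.continuousAt (Icc_mem_nhds ht (by linarith))
  have hineq : ∀ z ∈ K, ∀ s t, 0 < s → s ≤ t →
      ‖X t - z‖ ^ 2 - ‖X s - z‖ ^ 2 ≤ ∫ r in s..t, 2 * ⟪X r - z, Y r⟫ := by
    intro z hz s t hs hst
    have ht : 0 ≤ t := hs.le.trans hst
    have hlim : Tendsto (fun n => ∫ r in s..t, 2 * ⟪Xn n r - z, Yn n r⟫) atTop
        (𝓝 (∫ r in s..t, 2 * ⟪X r - z, Y r⟫)) := by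
      refine intervalIntegral.tendsto_integral_filter_of_dominated_convergence
        (fun _ => 2 * ((‖x‖ + M t * t + ‖z‖) * (‖v‖ + M t * t))) ?_ ?_ (by simp) ?_
      · refine Eventually.of_forall fun n => Continuous.aestronglyMeasurable ?_
        have h1 := (hsol n).continuous_fst
        have h2 := (hsol n).continuous_snd
        fun_prop
      · refine Eventually.of_forall fun n => Eventually.of_forall fun r hr => ?_
        rw [uIoc_of_le hst] at hr
        obtain ⟨h1, h2⟩ := hbound t ht n r ⟨(hs.trans hr.1).le, hr.2⟩
        rw [norm_mul, Real.norm_ofNat]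
        refine mul_le_mul_of_nonneg_left ?_ zero_le_two
        refine (norm_inner_le_norm _ _).trans ?_
        have h3 := norm_sub_le (Xn n r) z
        exact mul_le_mul (by linarith) h2 (norm_nonneg _) (by linarith [norm_nonneg (Xn n r - z)])
      · refine Eventually.of_forall fun r hr => ?_
        rw [uIoc_of_le hst] at hr
        have hr0 : 0 ≤ r := (hs.trans hr.1).le
        exact (((hX r hr0).sub_const z).inner (hY r hr0)).const_mul 2
    exact le_of_tendsto_of_tendsto' (((((hX t ht).sub_const z).norm).pow 2).sub
      (((hX s hs.le).sub_const z).norm.pow 2)) hlim fun n =>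
        (hsol n).norm_sub_sq_sub_le hP (by positivity) hz hst
  refine ⟨X, hXK, hX0, hXLip, ?_⟩
  rw [ae_restrict_iff' measurableSet_Ioi]
  filter_upwards [ae_differentiableAt_of_locallyLipschitz hXLip] with t hdiff ht
  have hd := (hdiff ht).hasDerivAt
  refine ⟨_, hd, fun z hz => ?_⟩
  rw [← hYint t (le_of_lt ht)]
  have hcontOn : ContinuousOn (fun r => 2 * ⟪X r - z, Y r⟫) (Ioi 0) := fun r hr => by
    have h1 := hcont hXLip r hr
    have h2 := hcont hYLip r hr
    exact ContinuousAt.continuousWithinAt (by fun_prop)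
  have hint : HasDerivAt (fun s => ∫ r in t..s, 2 * ⟪X r - z, Y r⟫) (2 * ⟪X t - z, Y t⟫) t :=
    intervalIntegral.integral_hasDerivAt_right (by simp)
      (hcontOn.stronglyMeasurableAtFilter isOpen_Ioi t ht)
      (hcontOn.continuousAt (isOpen_Ioi.mem_nhds ht))
  have hder := ((hd.sub_const z).norm_sq.sub hint)
  have hnonpos : 2 * ⟪X t - z, deriv X t⟫ - 2 * ⟪X t - z, Y t⟫ ≤ 0 := by
    have hslope := (hasDerivAt_iff_tendsto_slope.1 hder).mono_left
      (nhdsWithin_mono t (fun s (hs : t < s) => hs.ne') : 𝓝[>] t ≤ 𝓝[≠] t)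
    refine le_of_tendsto hslope (eventually_nhdsWithin_of_forall fun s hs => ?_)
    have h1 := hineq z hz t s ht (le_of_lt hs)
    rw [slope_def_field]
    refine div_nonpos_of_nonpos_of_nonneg ?_ (sub_nonneg.2 (le_of_lt hs))
    simp only [Pi.sub_apply, intervalIntegral.integral_same]
    linarith
  rw [← neg_sub (X t) z, inner_neg_right, real_inner_comm, inner_sub_right]
  linarith

end Existence

section Uniqueness

variable {H : Type*} [NormedAddCommGroup H] [InnerProductSpace ℝ H] {K : Set H} {F : H → H}

/-- Grönwall's inequality for the energy `‖Z‖² + ‖Y‖²` of a Lipschitz and a `C¹` curve. -/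
lemma energy_le_of_ae_deriv_le {Z Y G : ℝ → H} {c ε T : ℝ} {L : ℝ≥0} (hc : 0 ≤ c) (hε : 0 ≤ ε)
    (hT : 0 ≤ T) (hZ : LipschitzOnWith L Z (Icc 0 T)) (hY : ∀ t, HasDerivAt Y (G t) t)
    (hG : Continuous G)
    (hd : ∀ᵐ t, t ∈ Ioo 0 T → ∃ V, HasDerivAt Z V t ∧
      2 * ⟪Z t, V⟫ + 2 * ⟪Y t, G t⟫ ≤ c * (‖Z t‖ ^ 2 + ‖Y t‖ ^ 2) + ε) :
    ‖Z T‖ ^ 2 + ‖Y T‖ ^ 2 ≤ Real.exp (c * T) * (‖Z 0‖ ^ 2 + ‖Y 0‖ ^ 2 + ε * T) := by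
  have hZn : AbsolutelyContinuousOnInterval (fun t => ‖Z t‖) 0 T := by
    refine LipschitzOnWith.absolutelyContinuousOnInterval (K := 1 * L) ?_
    rw [uIcc_of_le hT]
    exact lipschitzWith_one_norm.comp_lipschitzOnWith hZ
  have hY1 : ContDiff ℝ 1 Y := by
    rw [contDiff_one_iff_deriv]
    exact ⟨fun t => (hY t).differentiableAt, by rwa [funext fun t => (hY t).deriv]⟩
  have hYn : AbsolutelyContinuousOnInterval (fun t => ‖Y t‖ ^ 2) 0 T :=
    (hY1.norm_sq ℝ).contDiffOn.absolutelyContinuousOnInterval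
  have hq : AbsolutelyContinuousOnInterval (fun t => ‖Z t‖ ^ 2 + ‖Y t‖ ^ 2) 0 T := by
    simp only [pow_two (‖Z _‖)]
    exact (hZn.mul hZn).add hYn
  refine hq.le_exp_mul_of_ae_deriv_le hc hε hT ?_
  filter_upwards [hd] with t ht htm
  obtain ⟨V, hV, hle⟩ := ht htm
  exact ⟨_, hle, hV.norm_sq.add (hY t).norm_sq⟩

namespace IsEvolutionSol

variable {x v : H} {X X' : ℝ → H}

lemma continuous_force {L : ℝ≥0} (hF : LipschitzOnWith L F K) (h : IsEvolutionSol K F x v X) :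
    Continuous fun t => F (X (max t 0)) := by
  have hX : ContinuousOn X (Ici 0) := by
    intro t ht
    obtain ⟨M, hM⟩ := h.2.2.1 (t + 1)
    have ht0 : (0 : ℝ) ≤ t := ht
    refine (hM.continuousOn t ⟨ht, by linarith⟩).mono_of_mem_nhdsWithin ?_
    rw [mem_nhdsWithin]
    exact ⟨Iio (t + 1), isOpen_Iio, by simp, fun s hs => ⟨hs.2, le_of_lt hs.1⟩⟩
  exact hF.continuousOn.comp_continuous
    (hX.comp_continuous (by fun_prop) fun t => mem_Ici.2 (le_max_right _ _))
    fun t => h.1 _ (le_max_right _ _)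

/-- The velocity is the orthogonal part of the momentum. -/
lemma inner_velocity_eq_zero (h : IsEvolutionSol K F x v X) {t : ℝ} (ht : 0 < t) {w V : H}
    (hV : HasDerivAt X V t) (hw : ∀ y ∈ K, ⟪w, y - X t⟫ ≤ 0) : ⟪w, V⟫ = 0 := by
  have hd : HasDerivAt (fun s => ⟪w, X s - X t⟫) ⟪w, V⟫ t := by
    simpa using (hasDerivAt_const t w).inner ℝ (hV.sub_const (X t))
  have hmax : IsLocalMax (fun s => ⟪w, X s - X t⟫) t := by
    filter_upwards [Ioi_mem_nhds ht] with s hs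
    simpa using hw _ (h.1 s (le_of_lt hs))
  exact hmax.hasDerivAt_eq_zero hd

variable [CompleteSpace H]

/-- The momentum `v + ∫ F(X)` of a solution extends to a `C¹` curve on the line. -/
lemma exists_momentum {L : ℝ≥0} (hF : LipschitzOnWith L F K) (h : IsEvolutionSol K F x v X) :
    ∃ Y : ℝ → H, Y 0 = v ∧ (∀ t, HasDerivAt Y (F (X (max t 0))) t) ∧
      ∀ᵐ t, 0 < t → ∃ V : H, HasDerivAt X V t ∧ ∀ y ∈ K, ⟪Y t - V, y - X t⟫ ≤ 0 := by
  have hc := h.continuous_force hF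
  refine ⟨fun t => v + ∫ s in (0 : ℝ)..t, F (X (max s 0)), by simp, fun t => ?_, ?_⟩
  · exact (intervalIntegral.integral_hasDerivAt_right (hc.intervalIntegrable _ _)
      hc.stronglyMeasurable.stronglyMeasurableAtFilter hc.continuousAt).const_add v
  · filter_upwards [(ae_restrict_iff' measurableSet_Ioi).1 h.2.2.2] with t ht ht0
    have : ∫ s in (0 : ℝ)..t, F (X (max s 0)) = ∫ s in Ioc (0 : ℝ) t, F (X s) := by
      rw [intervalIntegral.integral_of_le ht0.le]
      refine setIntegral_congr_fun measurableSet_Ioc fun s hs => ?_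
      simp only [max_eq_left hs.1.le]
    simpa only [this] using ht ht0

theorem unique {L : ℝ≥0} (hF : LipschitzOnWith L F K) (h : IsEvolutionSol K F x v X)
    (h' : IsEvolutionSol K F x v X') {T : ℝ} (hT : 0 ≤ T) : X' T = X T := by
  obtain ⟨Y, hY0, hY, hYV⟩ := h.exists_momentum hF
  obtain ⟨Y', hY0', hY', hYV'⟩ := h'.exists_momentum hF
  obtain ⟨M, hM⟩ := h.2.2.1 T
  obtain ⟨M', hM'⟩ := h'.2.2.1 T
  have key := energy_le_of_ae_deriv_le (c := 1 + L) (ε := 0) (by positivity) le_rfl hT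
    (hM'.sub hM) (fun t => (hY' t).sub (hY t))
    ((h'.continuous_force hF).sub (h.continuous_force hF)) (by
      filter_upwards [hYV, hYV'] with t ht ht' htm
      obtain ⟨V, hV, hVn⟩ := ht htm.1
      obtain ⟨V', hV', hVn'⟩ := ht' htm.1
      refine ⟨V' - V, hV'.sub hV, ?_⟩
      have h1 := hVn _ (h'.1 t htm.1.le)
      have h2 := hVn' _ (h.1 t htm.1.le)
      rw [← neg_sub (X' t), inner_neg_right] at h2
      have h3 := hF.dist_le_mul _ (h'.1 t htm.1.le) _ (h.1 t htm.1.le)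
      rw [dist_eq_norm, dist_eq_norm] at h3
      have h4 := energy_deriv_le (δ := 0) L.coe_nonneg (y := Y' t - Y t) h3
        (w := (Y' t - V') - (Y t - V)) (by rw [inner_sub_left]; linarith)
      rw [show Y' t - Y t - (Y' t - V' - (Y t - V)) = V' - V by abel] at h4
      simpa [max_eq_left htm.1.le] using h4)
  simp only [Pi.sub_apply, h.2.1, h'.2.1, hY0, hY0', sub_self, norm_zero] at key
  have h5 : ‖X' T - X T‖ ^ 2 ≤ 0 := by nlinarith [sq_nonneg ‖Y' T - Y T‖]
  exact sub_eq_zero.1 (norm_eq_zero.1 (pow_eq_zero_iff two_ne_zero |>.1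
    (le_antisymm h5 (sq_nonneg _))))

theorem norm_add_norm_deriv_le {L : ℝ≥0} (hF : LipschitzOnWith L F K) {C : ℝ} (hC : 0 ≤ C)
    (hbd : ∀ y ∈ K, ‖F y‖ ≤ C * (1 + ‖y‖)) (h : IsEvolutionSol K F x v X) {T : ℝ} (hT : 0 ≤ T) :
    ∀ᵐ t ∂(volume.restrict (Icc (0 : ℝ) T)), ∀ V, HasDerivAt X V t →
      ‖X t‖ + ‖V‖ ≤ √(2 * Real.exp ((1 + 2 * C) * T) * (1 + C * T)) * (1 + ‖x‖ + ‖v‖) := by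
  obtain ⟨Y, hY0, hY, hYV⟩ := h.exists_momentum hF
  have hV : ∀ᵐ t, 0 < t → ∃ V : H, HasDerivAt X V t ∧ ⟪X t, V⟫ ≤ ‖X t‖ * ‖Y t‖ ∧
      ‖V‖ ≤ ‖Y t‖ := by
    filter_upwards [hYV] with t ht ht0
    obtain ⟨V, hV, hn⟩ := ht ht0
    have h0 := h.inner_velocity_eq_zero ht0 hV hn
    rw [inner_sub_left, real_inner_self_eq_norm_sq] at h0
    have hle : ‖V‖ ≤ ‖Y t‖ := by
      by_contra! hlt
      nlinarith [real_inner_le_norm (Y t) V, norm_nonneg (Y t)]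
    exact ⟨V, hV, (real_inner_le_norm _ _).trans
      (mul_le_mul_of_nonneg_left hle (norm_nonneg _)), hle⟩
  have key : ∀ t ∈ Icc 0 T, ‖X t‖ ^ 2 + ‖Y t‖ ^ 2 ≤
      Real.exp ((1 + 2 * C) * T) * ((1 + C * T) * (1 + ‖x‖ + ‖v‖) ^ 2) := by
    intro t ht
    obtain ⟨M, hM⟩ := h.2.2.1 t
    have := energy_le_of_ae_deriv_le (c := 1 + 2 * C) (ε := C) (by positivity) hC ht.1 hM hY
      (h.continuous_force hF) (by
        filter_upwards [hV] with s hs hsm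
        obtain ⟨V, hV, hXV, -⟩ := hs hsm.1
        refine ⟨V, hV, ?_⟩
        rw [max_eq_left hsm.1.le]
        have h1 := (real_inner_le_norm (Y s) (F (X s))).trans
          (mul_le_mul_of_nonneg_left (hbd _ (h.1 s hsm.1.le)) (norm_nonneg _))
        nlinarith [sq_nonneg (‖X s‖ - ‖Y s‖), mul_nonneg hC (sq_nonneg (‖X s‖ - ‖Y s‖)),
          mul_nonneg hC (sq_nonneg (‖Y s‖ - 1)), mul_nonneg hC (sq_nonneg ‖X s‖)])
    rw [h.2.1, hY0] at this
    refine this.trans (mul_le_mul (Real.exp_le_exp.2 ?_) ?_ ?_ (Real.exp_pos _).le)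
    · exact mul_le_mul_of_nonneg_left ht.2 (by positivity)
    · have h1 := mul_le_mul_of_nonneg_left ht.2 hC
      have hx := norm_nonneg x
      have hv := norm_nonneg v
      have h2 : ‖x‖ ^ 2 + ‖v‖ ^ 2 + 1 ≤ (1 + ‖x‖ + ‖v‖) ^ 2 := by
        nlinarith [mul_nonneg hx hv]
      have h3 : 0 ≤ C * T := by positivity
      nlinarith [mul_le_mul_of_nonneg_left h2 h3, mul_nonneg h3 (sq_nonneg ‖x‖),
        mul_nonneg h3 (sq_nonneg ‖v‖)]
    · have := mul_nonneg hC ht.1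
      positivity
  rw [ae_restrict_iff' measurableSet_Icc]
  have hne : ∀ᵐ t : ℝ, t ≠ 0 := by simp [ae_iff, measure_singleton]
  filter_upwards [hV, hne] with t ht ht0 htm V hVt
  obtain ⟨W, hW, -, hWn⟩ := ht (lt_of_le_of_ne htm.1 (Ne.symm ht0))
  rw [hVt.unique hW]
  refine (add_le_add_right hWn _).trans ?_
  refine le_of_sq_le_sq ?_ (by positivity)
  rw [mul_pow, Real.sq_sqrt (by positivity)]
  nlinarith [key t htm, sq_nonneg (‖X t‖ - ‖Y t‖)]

end IsEvolutionSol

end Uniqueness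

section MonotoneCone

lemma convex_Kcone : Convex ℝ Kcone := by
  rintro X ⟨g, hg, hXg⟩ Y ⟨k, hk, hYk⟩ a b ha hb -
  refine ⟨fun m => a * g m + b * k m, fun s hs t ht hst => add_le_add
    (mul_le_mul_of_nonneg_left (hg hs ht hst) ha)
    (mul_le_mul_of_nonneg_left (hk hs ht hst) hb), ?_⟩
  filter_upwards [Lp.coeFn_add (a • X) (b • Y), Lp.coeFn_smul a X, Lp.coeFn_smul b Y, hXg, hYk]
    with m h1 h2 h3 h4 h5
  rw [h1, Pi.add_apply, h2, h3, Pi.smul_apply, Pi.smul_apply, h4, h5, smul_eq_mul, smul_eq_mul]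

/-- A function which is monotone on a conull subset of `Omg` has a monotone representative. -/
lemma exists_monotoneOn_ae_eq {f : ℝ → ℝ} {S : Set ℝ} (hS : ∀ᵐ m ∂mu, m ∈ S)
    (hf : MonotoneOn f S) : ∃ g : ℝ → ℝ, MonotoneOn g Omg ∧ f =ᵐ[mu] g := by
  have hex : ∀ a b, 0 ≤ a → a < b → b ≤ 1 → ∃ s ∈ S, a < s ∧ s < b := by
    intro a b ha hab hb
    by_contra! hno
    have hnull : volume (Ioo a b) = 0 := by
      refine measure_mono_null (fun m hm => ?_) (ae_iff.1
        ((ae_restrict_iff' measurableSet_Ioo).1 hS))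
      intro hmem
      have := hno m (hmem ⟨ha.trans_lt hm.1, hm.2.trans_le hb⟩) hm.1
      exact absurd hm.2 this.not_gt
    rw [Real.volume_Ioo, ENNReal.ofReal_eq_zero] at hnull
    linarith
  have hbdd : ∀ m ∈ Omg, BddAbove (f '' (S ∩ Iic m)) := by
    intro m hm
    obtain ⟨s, hs, hms, -⟩ := hex m 1 hm.1.le hm.2 le_rfl
    refine ⟨f s, ?_⟩
    rintro _ ⟨r, hr, rfl⟩
    exact hf hr.1 hs (le_trans hr.2 hms.le)
  refine ⟨fun m => sSup (f '' (S ∩ Iic m)), fun a ha b hb hab => ?_, ?_⟩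
  · obtain ⟨s, hs, -, hsa⟩ := hex 0 a le_rfl ha.1 ha.2.le
    exact csSup_le_csSup (hbdd b hb) ⟨f s, s, ⟨hs, hsa.le⟩, rfl⟩
      (image_mono (inter_subset_inter_right _ (Iic_subset_Iic.2 hab)))
  · filter_upwards [hS] with m hm
    refine (IsGreatest.csSup_eq (s := f '' (S ∩ Iic m)) ⟨⟨m, ⟨hm, self_mem_Iic⟩, rfl⟩, ?_⟩).symm
    rintro _ ⟨r, hr, rfl⟩
    exact hf hr.1 hm hr.2

lemma isClosed_Kcone : IsClosed Kcone := by
  refine IsSeqClosed.isClosed fun X Z hX hlim => ?_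
  choose g hg hXg using hX
  obtain ⟨φ, -, hφ⟩ := (tendstoInMeasure_of_tendsto_Lp hlim).exists_seq_tendsto_ae
  refine exists_monotoneOn_ae_eq (S := {m | m ∈ Omg ∧ (∀ n, X n m = g n m) ∧
    Tendsto (fun n => X (φ n) m) atTop (nhds (Z m))}) ?_ ?_
  · filter_upwards [ae_restrict_mem measurableSet_Ioo, ae_all_iff.2 hXg, hφ] with m h1 h2 h3
    exact ⟨h1, h2, h3⟩
  · rintro s ⟨hs, hXs, hls⟩ t ⟨ht, hXt, hlt⟩ hst
    refine le_of_tendsto_of_tendsto' hls hlt fun n => ?_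
    rw [hXs, hXt]
    exact hg _ hs ht hst

instance : TopologicalSpace.SeparableSpace L2 := by
  have : Fact ((2 : ℝ≥0∞) ≠ ∞) := ⟨by simp⟩
  have : IsFiniteMeasure mu := by unfold mu Omg; infer_instance
  exact inferInstance

end MonotoneCone

/-- If `F : K → L²(Ω)` is Lipschitz (and linearly bounded), then for every
`(X̄, V̄) ∈ K × L²(Ω)` there is a unique Lagrangian solution with initial data `(X̄, V̄)`;
moreover for every `T ≥ 0` there is a constant `C_T ≥ 0`, independent of the initial data,
such that `‖X(t)‖ + ‖Ẋ(t)‖ ≤ C_T (1 + ‖X̄‖ + ‖V̄‖)` for a.e. `t ∈ [0,T]`. -/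
theorem stmt8 (F : L2 → L2) (L : ℝ≥0) (hLip : LipschitzOnWith L F Kcone)
    (C : ℝ) (hC : 0 ≤ C) (hbd : ∀ X ∈ Kcone, ‖F X‖ ≤ C * (1 + ‖X‖)) :
    (∀ Xbar ∈ Kcone, ∀ Vbar : L2,
      ∃ X : ℝ → L2, LagSol F Xbar Vbar X ∧
        ∀ X' : ℝ → L2, LagSol F Xbar Vbar X' → ∀ t : ℝ, 0 ≤ t → X' t = X t) ∧
    (∀ T : ℝ, 0 ≤ T → ∃ CT : ℝ, 0 ≤ CT ∧
      ∀ Xbar ∈ Kcone, ∀ Vbar : L2, ∀ X : ℝ → L2, LagSol F Xbar Vbar X →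
        ∀ᵐ t ∂(volume.restrict (Set.Icc (0:ℝ) T)),
          ∀ V : L2, HasDerivAt X V t →
            ‖X t‖ + ‖V‖ ≤ CT * (1 + ‖Xbar‖ + ‖Vbar‖)) := by
  refine ⟨fun Xbar hX Vbar => ?_, fun T hT => ⟨√(2 * Real.exp ((1 + 2 * C) * T) * (1 + C * T)),
    Real.sqrt_nonneg _, fun Xbar _ Vbar X hsol => ?_⟩⟩
  · obtain ⟨X, hsol⟩ := exists_isEvolutionSol isClosed_Kcone convex_Kcone hLip hX Vbar
    exact ⟨X, hsol, fun X' hsol' t ht => IsEvolutionSol.unique hLip hsol hsol' ht⟩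
  · exact IsEvolutionSol.norm_add_norm_deriv_le hLip hC hbd hsol hT
end
end

section
/- Suppose F : K → L²(Ω) is uniformly continuous and let X be a Lagrangian solution with initial data (X̄, V̄), with Y(t) := V̄ + ∫₀ᵗ F[X(s)] ds. Then there exists a set 𝒯 ⊆ (0,∞) whose complement in (0,∞) has Lebesgue measure zero such that for every t ∈ 𝒯 the curve X is differentiable at t in L²(Ω) and Ẋ(t) = P_{H_{X(t)}}( Y(t) ); in particular Ẋ(t) ∈ H_{X(t)} for every t ∈ 𝒯. -/
open MeasureTheory Set Filter
open scoped ENNReal NNReal RealInnerProductSpace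

noncomputable section

/-- `Ω_X`: points of `Ω` near which `X` is (essentially) constant. -/
def OmegaX (X : L2) : Set ℝ :=
  {m | m ∈ Omg ∧ ∃ U ∈ nhds m, ∃ c : ℝ, ∀ᵐ x ∂(mu.restrict U), X x = c}

/-- The closed subspace `H_X` of functions admitting a representative that is constant on
each connected component of `Ω_X`. -/
def HX (X : L2) : Set L2 :=
  {U | ∃ g : ℝ → ℝ, ⇑U =ᵐ[mu] g ∧
    ∀ m ∈ OmegaX X, ∀ m' ∈ connectedComponentIn (OmegaX X) m, g m' = g m}

/-- `P` is the orthogonal projection of `V` onto `H_X`. -/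
def IsProjHX (X V P : L2) : Prop := P ∈ HX X ∧ ∀ U ∈ HX X, ⟪V - P, U⟫ = 0

/-- `F` is uniformly continuous on `K`: linearly bounded and admitting a modulus of
continuity (a concave continuous `ω : [0,∞) → [0,∞)` with `ω(0) = 0 < ω(r)` for `r > 0`). -/
def UnifCont (F : L2 → L2) : Prop :=
  (∃ C : ℝ, 0 ≤ C ∧ ∀ X ∈ Kcone, ‖F X‖ ≤ C * (1 + ‖X‖)) ∧
  (∃ ω : ℝ → ℝ, ContinuousOn ω (Set.Ici 0) ∧ ConcaveOn ℝ (Set.Ici 0) ω ∧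
    (∀ r : ℝ, 0 ≤ r → 0 ≤ ω r) ∧ ω 0 = 0 ∧ (∀ r : ℝ, 0 < r → 0 < ω r) ∧
    ∀ X₁ ∈ Kcone, ∀ X₂ ∈ Kcone, ‖F X₁ - F X₂‖ ≤ ω ‖X₁ - X₂‖)

/-- `V` is a.e. equal to the constant `c` on an open interval around `m` inside `(0,1)`. -/
def LocallyAEConst (V : ℝ → ℝ) (m c : ℝ) : Prop :=
  ∃ a b, m ∈ Ioo a b ∧ Ioo a b ⊆ Omg ∧ ∀ᵐ x, x ∈ Ioo a b → V x = c

theorem measurableSet_Omg : MeasurableSet Omg := measurableSet_Ioo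

theorem ae_mu_iff {p : ℝ → Prop} : (∀ᵐ x ∂mu, p x) ↔ ∀ᵐ x, x ∈ Omg → p x :=
  ae_restrict_iff' measurableSet_Omg

theorem integral_mu (f : ℝ → ℝ) : ∫ x, f x ∂mu = ∫ x, Omg.indicator f x :=
  (integral_indicator measurableSet_Omg).symm

instance : IsFiniteMeasure mu := by
  unfold mu Omg
  infer_instance

theorem mem_OmegaX_iff {X : L2} {m : ℝ} : m ∈ OmegaX X ↔ ∃ c, LocallyAEConst X m c := by
  constructor
  · rintro ⟨hm, U, hU, c, hc⟩
    obtain ⟨a, b, hab, hI⟩ := mem_nhds_iff_exists_Ioo_subset.1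
      (inter_mem hU (isOpen_Ioo.mem_nhds hm : Omg ∈ nhds m))
    refine ⟨c, a, b, hab, fun x hx => (hI hx).2, ?_⟩
    have h1 : ∀ᵐ x ∂(mu.restrict (Ioo a b)), X x = c :=
      ae_restrict_of_ae_restrict_of_subset (fun x hx => (hI hx).1) hc
    rw [ae_restrict_iff' measurableSet_Ioo, ae_mu_iff] at h1
    filter_upwards [h1] with x hx hxI using hx (hI hxI).2 hxI
  · rintro ⟨c, a, b, hm, hI, hc⟩
    refine ⟨hI hm, Ioo a b, isOpen_Ioo.mem_nhds hm, c, ?_⟩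
    rw [ae_restrict_iff' measurableSet_Ioo, ae_mu_iff]
    filter_upwards [hc] with x hx _ hxI using hx hxI

theorem LocallyAEConst.unique {V : ℝ → ℝ} {m c d : ℝ} (hc : LocallyAEConst V m c)
    (hd : LocallyAEConst V m d) : c = d := by
  obtain ⟨a, b, hm, -, h⟩ := hc
  obtain ⟨a', b', hm', -, h'⟩ := hd
  have hpos : 0 < volume (Ioo a b ∩ Ioo a' b') :=
    (isOpen_Ioo.inter isOpen_Ioo).measure_pos volume ⟨m, hm, hm'⟩
  by_contra hne
  have hnull : ∀ᵐ x, x ∉ Ioo a b ∩ Ioo a' b' := by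
    filter_upwards [h, h'] with x hx hx' hxI
    exact hne ((hx hxI.1).symm.trans (hx' hxI.2))
  exact hpos.ne' (measure_eq_zero_iff_ae_notMem.2 hnull)

theorem isOpen_OmegaX (X : L2) : IsOpen (OmegaX X) := by
  rw [isOpen_iff_mem_nhds]
  intro m hm
  obtain ⟨c, a, b, hm, hI, hc⟩ := mem_OmegaX_iff.1 hm
  filter_upwards [isOpen_Ioo.mem_nhds hm] with y hy
  exact mem_OmegaX_iff.2 ⟨c, a, b, hy, hI, hc⟩

/-- Local a.e. constancy on `Ω_X` suffices for membership in `H_X`. -/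
theorem mem_HX_of_locallyAEConst {X V : L2}
    (h : ∀ m ∈ OmegaX X, ∃ c, LocallyAEConst V m c) : V ∈ HX X := by
  classical
  let g : ℝ → ℝ := fun x => if hx : ∃ c, LocallyAEConst V x c then hx.choose else V x
  have hg : ∀ {m c}, LocallyAEConst V m c → g m = c := by
    intro m c hc
    have hex : ∃ c, LocallyAEConst V m c := ⟨c, hc⟩
    simp only [g, dif_pos hex]
    exact hex.choose_spec.unique hc
  have hloc : ∀ {m c}, LocallyAEConst V m c → ∃ U ∈ nhds m, (∀ y ∈ U, g y = c) ∧
      ∀ᵐ x, x ∈ U → V x = c := by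
    rintro m c ⟨a, b, hm, hI, hc⟩
    exact ⟨Ioo a b, isOpen_Ioo.mem_nhds hm, fun y hy => hg ⟨a, b, hy, hI, hc⟩, hc⟩
  refine ⟨g, ?_, ?_⟩
  · refine ae_restrict_of_ae ?_
    change volume {x | ¬ (V x = g x)} = 0
    refine measure_null_of_locally_null _ fun x hx => ?_
    by_cases hex : ∃ c, LocallyAEConst V x c
    · obtain ⟨c, hc⟩ := hex
      obtain ⟨U, hU, hgU, hV⟩ := hloc hc
      refine ⟨U ∩ {x | ¬ (V x = g x)}, inter_mem (mem_nhdsWithin_of_mem_nhds hU)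
        self_mem_nhdsWithin, measure_eq_zero_iff_ae_notMem.2 ?_⟩
      filter_upwards [hV] with y hy hyU
      exact hyU.2 ((hy hyU.1).trans (hgU y hyU.1).symm)
    · exact absurd (by simp only [g, dif_neg hex]) hx
  · intro m hm m' hm'
    refine isPreconnected_connectedComponentIn.induction₂ (fun x y => g x = g y) (fun x hx => ?_)
      (fun x y z _ _ _ h1 h2 => h1.trans h2) (fun x y _ _ h1 => h1.symm) hm'
      (mem_connectedComponentIn hm)
    obtain ⟨c, hc⟩ := h x (connectedComponentIn_subset _ _ hx)
    obtain ⟨U, hU, hgU, -⟩ := hloc hc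
    filter_upwards [mem_nhdsWithin_of_mem_nhds hU] with y hy
    rw [hgU y hy, hgU x (mem_of_mem_nhds hU)]

theorem exists_monotoneOn_of_tendsto {Z : ℕ → L2} {V : L2} (hZ : Tendsto Z atTop (nhds V))
    {I : Set ℝ}
    (hm : ∀ n, ∃ g : ℝ → ℝ, MonotoneOn g I ∧ ∀ᵐ x ∂mu, x ∈ I → Z n x = g x) :
    ∃ S : Set ℝ, (∀ᵐ x ∂mu, x ∈ I → x ∈ S) ∧ MonotoneOn V S := by
  obtain ⟨ns, -, hns⟩ := (tendstoInMeasure_of_tendsto_Lp hZ).exists_seq_tendsto_ae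
  choose g hg hZg using hm
  refine ⟨{x | x ∈ I ∧ (∀ n, Z n x = g n x) ∧
    Tendsto (fun i => Z (ns i) x) atTop (nhds (V x))}, ?_, ?_⟩
  · filter_upwards [ae_all_iff.2 hZg, hns] with x h1 h2 hx
    exact ⟨hx, fun n => h1 n hx, h2⟩
  · intro x hx y hy hxy
    refine le_of_tendsto_of_tendsto' hx.2.2 hy.2.2 fun i => ?_
    rw [hx.2.1, hy.2.1]
    exact hg _ hx.1 hy.1 hxy

theorem smul_sub_monotoneOn {X Y : L2} (hY : Y ∈ Kcone) {r : ℝ} (hr : 0 ≤ r) {c : ℝ}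
    {I : Set ℝ} (hI : I ⊆ Omg) (hX : ∀ᵐ x, x ∈ I → X x = c) :
    ∃ g : ℝ → ℝ, MonotoneOn g I ∧ ∀ᵐ x ∂mu, x ∈ I → (r • (Y - X) : L2) x = g x := by
  obtain ⟨k, hk, hYk⟩ := hY
  refine ⟨fun x => r * (k x - c), fun x hx y hy hxy => ?_, ?_⟩
  · have := hk (hI hx) (hI hy) hxy
    dsimp only
    gcongr
  · filter_upwards [Lp.coeFn_smul r (Y - X), Lp.coeFn_sub Y X, hYk, ae_restrict_of_ae hX]
      with x h1 h2 h3 h4 hx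
    rw [h1, Pi.smul_apply, h2, Pi.sub_apply, h3, h4 hx, smul_eq_mul]

/-- A velocity of a curve in `K` at an interior time belongs to `H_X`. -/
theorem deriv_mem_HX {X : ℝ → L2} {t : ℝ} {V : L2} (ht : 0 < t)
    (hK : ∀ s, 0 ≤ s → X s ∈ Kcone) (hV : HasDerivAt X V t) : V ∈ HX (X t) := by
  refine mem_HX_of_locallyAEConst fun m hm => ?_
  obtain ⟨c, a, b, hm, hI, hc⟩ := mem_OmegaX_iff.1 hm
  let h : ℕ → ℝ := fun n => t / ((n : ℝ) + 1)
  have hpos : ∀ n, 0 < h n := fun n => by positivity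
  have hle : ∀ n, h n ≤ t := fun n => div_le_self ht.le (by simp)
  have hlim : Tendsto h atTop (nhds 0) := by
    simpa [h, div_eq_mul_inv] using (tendsto_one_div_add_atTop_nhds_zero_nat (𝕜 := ℝ)).const_mul t
  have hs := hasDerivAt_iff_tendsto_slope.1 hV
  have hp : Tendsto (fun n => t + h n) atTop (nhdsWithin t {t}ᶜ) := by
    refine tendsto_nhdsWithin_iff.2 ⟨by simpa using hlim.const_add t, .of_forall fun n => ?_⟩
    simpa using (hpos n).ne'
  have hm' : Tendsto (fun n => t - h n) atTop (nhdsWithin t {t}ᶜ) := by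
    refine tendsto_nhdsWithin_iff.2 ⟨by simpa using hlim.const_sub t, .of_forall fun n => ?_⟩
    simpa using (hpos n).ne'
  obtain ⟨S, hS, hVS⟩ := exists_monotoneOn_of_tendsto (I := Ioo a b) (hs.comp hp) fun n => by
    have := smul_sub_monotoneOn (hK (t + h n) (by linarith [hpos n])) (inv_nonneg.2 (hpos n).le)
      hI hc
    simpa [slope_def_module] using this
  obtain ⟨S', hS', hVS'⟩ := exists_monotoneOn_of_tendsto (I := Ioo a b) (hs.comp hm').neg
    fun n => by
    have := smul_sub_monotoneOn (hK (t - h n) (by linarith [hle n])) (inv_nonneg.2 (hpos n).le)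
      hI hc
    have heq : -(slope X t ∘ fun n => t - h n) n = (h n)⁻¹ • (X (t - h n) - X t) := by
      simp [slope_def_module, inv_neg]
    rwa [heq]
  have hneg : ∀ᵐ x ∂mu, (-V : L2) x = - V x := Lp.coeFn_neg V
  have key : ∀ᵐ x, x ∈ Ioo a b → x ∈ S ∧ x ∈ S' ∧ (-V : L2) x = - V x := by
    filter_upwards [ae_mu_iff.1 hS, ae_mu_iff.1 hS', ae_mu_iff.1 hneg] with x h1 h2 h3 hx
    exact ⟨h1 (hI hx) hx, h2 (hI hx) hx, h3 (hI hx)⟩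
  have hconst : ∀ x y, x ≤ y → (x ∈ S ∧ x ∈ S' ∧ (-V : L2) x = - V x) →
      (y ∈ S ∧ y ∈ S' ∧ (-V : L2) y = - V y) → V x = V y := by
    intro x y hxy hx hy
    have h1 := hVS hx.1 hy.1 hxy
    have h2 := hVS' hx.2.1 hy.2.1 hxy
    rw [hx.2.2, hy.2.2] at h2
    linarith
  have hne : ∃ x, x ∈ S ∧ x ∈ S' ∧ (-V : L2) x = - V x := by
    by_contra hno
    have hnull : ∀ᵐ x, x ∉ Ioo a b := by
      filter_upwards [key] with x hx hxI using hno ⟨x, hx hxI⟩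
    exact (isOpen_Ioo.measure_pos volume ⟨m, hm⟩).ne' (measure_eq_zero_iff_ae_notMem.2 hnull)
  obtain ⟨x₀, hx₀⟩ := hne
  refine ⟨V x₀, a, b, hm, hI, ?_⟩
  filter_upwards [key] with x hx hxI
  rcases le_total x x₀ with hle | hle
  · exact hconst _ _ hle (hx hxI) hx₀
  · exact (hconst _ _ hle hx₀ (hx hxI)).symm

theorem inner_toLp (W : L2) {k : ℝ → ℝ} (hk : MemLp k 2 mu) :
    ⟪W, hk.toLp k⟫ = ∫ x, W x * k x ∂mu := by
  rw [L2.inner_def]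
  refine integral_congr_ae ?_
  filter_upwards [hk.coeFn_toLp] with x hx
  simp [hx, mul_comm]

theorem integral_mul_nonpos {X W : L2} (hX : X ∈ Kcone) (hW : W ∈ normalCone X) {k : ℝ → ℝ}
    (hk : MemLp k 2 mu) (hmono : MonotoneOn k Omg) : ∫ x, W x * k x ∂mu ≤ 0 := by
  obtain ⟨g, hg, hXg⟩ := hX
  have := hW (X + hk.toLp k) ⟨fun x => g x + k x, hg.add hmono, by
    filter_upwards [Lp.coeFn_add X (hk.toLp k), hXg, hk.coeFn_toLp] with x h1 h2 h3
    rw [h1, Pi.add_apply, h2, h3]⟩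
  rwa [add_sub_cancel_left, inner_toLp] at this

theorem integral_normalCone_eq_zero {X W : L2} (hX : X ∈ Kcone) (hW : W ∈ normalCone X) :
    ∫ x, W x ∂mu = 0 := by
  have h1 := integral_mul_nonpos hX hW (memLp_const (1 : ℝ)) monotoneOn_const
  have h2 := integral_mul_nonpos hX hW (memLp_const (-1 : ℝ)) monotoneOn_const
  simp only [mul_one, mul_neg, integral_neg] at h1 h2
  linarith

theorem integral_mul_self_nonneg {X W : L2} (hW : W ∈ normalCone X) :
    0 ≤ ∫ x, W x * X x ∂mu := by
  have := hW 0 ⟨fun _ => 0, monotoneOn_const, Lp.coeFn_zero _ _ _⟩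
  rw [zero_sub, inner_neg_right, L2.inner_def] at this
  simpa [mul_comm] using this

theorem integrable_L2_mul (W : L2) {k : ℝ → ℝ} (hk : MemLp k 2 mu) :
    Integrable (fun x => W x * k x) mu := (Lp.memLp W).integrable_mul hk

theorem integrable_L2 (W : L2) : Integrable W mu := (Lp.memLp W).integrable (by norm_num)

theorem integral_clip_eq_zero {X W : L2} (hX : X ∈ Kcone) (hW : W ∈ normalCone X) {g : ℝ → ℝ}
    (hg : MonotoneOn g Omg) (hXg : ⇑X =ᵐ[mu] g) (s : ℝ) (n : ℕ) :
    ∫ x, W x * max 0 (min 1 (n * (g x - s))) ∂mu = 0 := by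
  have hgm : MemLp g 2 mu := (Lp.memLp X).ae_eq hXg
  set k : ℝ → ℝ := fun x => max 0 (min 1 (n * (g x - s))) with hkdef
  have hkm : AEStronglyMeasurable k mu := by
    have := hgm.1.aemeasurable
    exact AEMeasurable.aestronglyMeasurable (by fun_prop)
  have hk : MemLp k 2 mu := MemLp.of_bound hkm 1 (.of_forall fun x => by
    rw [Real.norm_eq_abs, abs_of_nonneg (le_max_left _ _)]
    exact max_le zero_le_one (min_le_left _ _))
  have hkmono : MonotoneOn k Omg := fun x hx y hy hxy => by
    have := hg hx hy hxy
    simp only [k]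
    gcongr
  have hdmono : MonotoneOn (fun x => n * g x - k x) Omg := fun x hx y hy hxy => by
    have h := mul_le_mul_of_nonneg_left (hg hx hy hxy) (Nat.cast_nonneg (α := ℝ) n)
    simp only [k, mul_sub]
    generalize (n : ℝ) * g x = p at *
    generalize (n : ℝ) * g y = q at *
    generalize (n : ℝ) * s = r at *
    rcases max_cases 0 (min 1 (p - r)) with h1 | h1 <;>
      rcases max_cases 0 (min 1 (q - r)) with h2 | h2 <;>
      rcases min_cases 1 (p - r) with h3 | h3 <;>
      rcases min_cases 1 (q - r) with h4 | h4 <;> linarith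
  have hng : MemLp (fun x => n * g x) 2 mu := hgm.const_mul _
  have h1 := integral_mul_nonpos hX hW hk hkmono
  have h2 := integral_mul_nonpos hX hW (hng.sub hk) hdmono
  have h3 := integral_mul_self_nonneg hW
  have h4 : ∫ x, W x * X x ∂mu = ∫ x, W x * g x ∂mu :=
    integral_congr_ae (by filter_upwards [hXg] with x hx; rw [hx])
  have h5 : ∫ x, W x * (((fun x => n * g x) - k) x) ∂mu
      = n * ∫ x, W x * g x ∂mu - ∫ x, W x * k x ∂mu := by
    rw [← integral_const_mul, ← integral_sub ((integrable_L2_mul W hgm).const_mul _)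
      (integrable_L2_mul W hk)]
    congr 1
    ext x
    simp only [Pi.sub_apply]
    ring
  have h6 : 0 ≤ (n : ℝ) * ∫ x, W x * g x ∂mu := mul_nonneg (Nat.cast_nonneg n) (h4 ▸ h3)
  have h2' : ∫ x, W x * (((fun x => n * g x) - k) x) ∂mu ≤ 0 := h2
  linarith

theorem integral_indicator_superlevel_eq_zero {X W : L2} (hX : X ∈ Kcone) (hW : W ∈ normalCone X)
    {g : ℝ → ℝ} (hg : MonotoneOn g Omg) (hXg : ⇑X =ᵐ[mu] g) (s : ℝ) :
    ∫ x, {x | s < g x}.indicator W x ∂mu = 0 := by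
  have hgm : AEMeasurable g mu := ((Lp.memLp X).ae_eq hXg).1.aemeasurable
  refine tendsto_nhds_unique (tendsto_integral_of_dominated_convergence
    (F := fun (n : ℕ) x => W x * max 0 (min 1 (n * (g x - s)))) (fun x => |W x|)
    (fun n => ?_) (integrable_L2 W).abs (fun n => .of_forall fun x => ?_)
    (.of_forall fun x => ?_)) ?_
  · have := (Lp.memLp W).1.aemeasurable
    exact AEMeasurable.aestronglyMeasurable (by fun_prop)
  · rw [Real.norm_eq_abs, abs_mul, abs_of_nonneg (le_max_left (0 : ℝ) _)]
    exact mul_le_of_le_one_right (abs_nonneg _) (max_le zero_le_one (min_le_left _ _))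
  · by_cases hx : s < g x
    · rw [indicator_of_mem (by exact hx)]
      refine tendsto_const_nhds.congr' ?_
      obtain ⟨N, hN⟩ := exists_nat_gt (1 / (g x - s))
      have hpos : 0 < g x - s := sub_pos.2 hx
      filter_upwards [eventually_ge_atTop N] with n hn
      have hn' : (N : ℝ) ≤ n := by exact_mod_cast hn
      have : 1 ≤ (n : ℝ) * (g x - s) := by
        rw [div_lt_iff₀ hpos] at hN
        nlinarith
      simp [min_eq_left this]
    · rw [indicator_of_notMem (by exact hx)]
      refine tendsto_const_nhds.congr fun n => ?_
      have : (n : ℝ) * (g x - s) ≤ 0 :=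
        mul_nonpos_of_nonneg_of_nonpos (Nat.cast_nonneg n) (by linarith)
      rw [max_eq_left ((min_le_right _ _).trans this), mul_zero]
  · simp only [integral_clip_eq_zero hX hW hg hXg]
    exact tendsto_const_nhds

/-- The primitive of `W ∈ L²(0,1)` vanishing at `0`. -/
def primitive (W : L2) (p : ℝ) : ℝ := ∫ x in (0:ℝ)..p, Omg.indicator W x

theorem integrable_indicator_L2 (W : L2) : Integrable (Omg.indicator W) :=
  (integrable_indicator_iff measurableSet_Omg).2 (integrable_L2 W)

theorem continuous_primitive_L2 (W : L2) : Continuous (primitive W) :=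
  (integrable_indicator_L2 W).continuous_primitive 0

theorem setIntegral_eq_primitive_sub (W : L2) {C : Set ℝ} {a b : ℝ} (hab : a ≤ b)
    (h1 : Ioo a b ⊆ C) (h2 : C ⊆ Icc a b) :
    ∫ x in C, Omg.indicator W x = primitive W b - primitive W a := by
  have hi := integrable_indicator_L2 W
  rw [primitive, primitive, intervalIntegral.integral_interval_sub_left hi.intervalIntegrable
    hi.intervalIntegrable, intervalIntegral.integral_of_le hab]
  refine setIntegral_congr_set ?_
  have e1 : Ioo a b ≤ᵐ[volume] C := .of_forall h1
  have e2 : C ≤ᵐ[volume] Icc a b := .of_forall h2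
  exact (e2.trans Ioc_ae_eq_Icc.symm.le).antisymm (Ioo_ae_eq_Ioc.symm.le.trans e1)

theorem primitive_zero (W : L2) : primitive W 0 = 0 := intervalIntegral.integral_same

theorem primitive_one {X W : L2} (hX : X ∈ Kcone) (hW : W ∈ normalCone X) :
    primitive W 1 = 0 := by
  have h := setIntegral_eq_primitive_sub W (C := Omg) zero_le_one subset_rfl Ioo_subset_Icc_self
  rw [primitive_zero, sub_zero, setIntegral_indicator measurableSet_Omg, inter_self] at h
  rw [← h]
  exact integral_normalCone_eq_zero hX hW

theorem exists_primitive_eq_zero {X W : L2} (hX : X ∈ Kcone) (hW : W ∈ normalCone X)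
    {g : ℝ → ℝ} (hg : MonotoneOn g Omg) (hXg : ⇑X =ᵐ[mu] g) {a b : ℝ} (ha : a ∈ Omg)
    (hb : b ∈ Omg) (hlt : g a < g b) : ∃ p ∈ Icc a b, primitive W p = 0 := by
  set A : Set ℝ := Omg ∩ {x | g a < g x} with hA
  have hbA : b ∈ A := ⟨hb, hlt⟩
  have hlow : a ∈ lowerBounds A := fun x hx => by
    by_contra hxa
    exact (hg hx.1 ha (not_le.1 hxa).le).not_gt hx.2
  have hbdd : BddBelow A := ⟨a, hlow⟩
  have hap : a ≤ sInf A := le_csInf ⟨b, hbA⟩ hlow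
  have hpb : sInf A ≤ b := csInf_le hbdd hbA
  refine ⟨sInf A, ⟨hap, hpb⟩, ?_⟩
  have h1 : Ioo (sInf A) 1 ⊆ A := fun x hx => by
    obtain ⟨y, hy, hyx⟩ := exists_lt_of_csInf_lt ⟨b, hbA⟩ hx.1
    have hxO : x ∈ Omg := ⟨hy.1.1.trans hyx, hx.2⟩
    exact ⟨hxO, lt_of_lt_of_le hy.2 (hg hy.1 hxO hyx.le)⟩
  have h2 : A ⊆ Icc (sInf A) 1 := fun x hx => ⟨csInf_le hbdd hx, hx.1.2.le⟩
  have h := setIntegral_eq_primitive_sub W (hpb.trans hb.2.le) h1 h2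
  have hAm : NullMeasurableSet A := by
    have e1 : Ioo (sInf A) 1 ≤ᵐ[volume] A := .of_forall h1
    have e2 : A ≤ᵐ[volume] Icc (sInf A) 1 := .of_forall h2
    exact (measurableSet_Ioo.nullMeasurableSet).congr
      (e1.antisymm (e2.trans Ioo_ae_eq_Icc.symm.le))
  rw [primitive_one hX hW, zero_sub, ← integral_indicator₀ hAm] at h
  have h0 := integral_indicator_superlevel_eq_zero hX hW hg hXg (g a)
  rw [integral_mu, indicator_indicator] at h0
  rw [indicator_indicator, inter_eq_left.2 (fun x hx => hx.1 : A ⊆ Omg), h0] at h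
  linarith

theorem primitive_eq_zero {X W : L2} (hX : X ∈ Kcone) (hW : W ∈ normalCone X) {m : ℝ}
    (hm : m ∈ Icc (0:ℝ) 1) (hmX : m ∉ OmegaX X) : primitive W m = 0 := by
  rcases hm.1.eq_or_lt with rfl | h0
  · exact primitive_zero W
  rcases hm.2.eq_or_lt with rfl | h1
  · exact primitive_one hX hW
  by_contra hne
  have hmO : Omg ∈ nhds m := isOpen_Ioo.mem_nhds ⟨h0, h1⟩
  obtain ⟨a, b, hab, hI⟩ := mem_nhds_iff_exists_Ioo_subset.1
    (inter_mem ((continuous_primitive_L2 W).continuousAt.eventually_ne hne) hmO)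
  obtain ⟨g, hg, hXg⟩ := id hX
  have hle : ∀ x ∈ Ioo a b, ∀ y ∈ Ioo a b, g y ≤ g x := fun x hx y hy => by
    by_contra! hlt
    obtain ⟨p, hp, hp0⟩ := exists_primitive_eq_zero hX hW hg hXg (hI hx).2 (hI hy).2 hlt
    exact (hI ⟨hx.1.trans_le hp.1, hp.2.trans_lt hy.2⟩).1 hp0
  refine hmX (mem_OmegaX_iff.2 ⟨g m, a, b, hab, fun x hx => (hI hx).2, ?_⟩)
  filter_upwards [ae_mu_iff.1 hXg] with x hx hxI
  rw [hx (hI hxI).2]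
  exact (hle _ hab _ hxI).antisymm (hle _ hxI _ hab)

/-- Elements of the normal cone vanish a.e. outside `Ω_X`. -/
theorem ae_eq_zero_of_notMem_OmegaX {X W : L2} (hX : X ∈ Kcone) (hW : W ∈ normalCone X) :
    ∀ᵐ x, x ∈ Omg \ OmegaX X → W x = 0 := by
  have hiso := (countable_setOfPred_isolated_right_within (s := Omg \ OmegaX X)).ae_notMem volume
  filter_upwards [LocallyIntegrable.ae_hasDerivAt_integral
    (integrable_indicator_L2 W).locallyIntegrable, hiso] with x hd hx hxS
  have hne : (nhdsWithin x ((Omg \ OmegaX X) ∩ Ioi x)).NeBot := ⟨fun h => hx ⟨hxS, h⟩⟩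
  have hd0 : HasDerivWithinAt (primitive W) (Omg.indicator W x) (Omg \ OmegaX X) x :=
    (hd 0).hasDerivWithinAt
  have hz : HasDerivWithinAt (primitive W) 0 (Omg \ OmegaX X) x :=
    (hasDerivWithinAt_const x (Omg \ OmegaX X) (0:ℝ)).congr
      (fun y hy => primitive_eq_zero hX hW (Ioo_subset_Icc_self hy.1) hy.2)
      (primitive_eq_zero hX hW (Ioo_subset_Icc_self hxS.1) hxS.2)
  have hu : UniqueDiffWithinAt ℝ (Omg \ OmegaX X) x := by
    rw [uniqueDiffWithinAt_iff_accPt, accPt_principal_iff_nhdsWithin]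
    exact hne.mono (nhdsWithin_mono x fun y hy => ⟨hy.1, ne_of_gt hy.2⟩)
  have := hu.eq_deriv _ hd0 hz
  rwa [indicator_of_mem hxS.1] at this

theorem setIntegral_component_eq_zero {X W : L2} (hX : X ∈ Kcone) (hW : W ∈ normalCone X)
    {m : ℝ} (hm : m ∈ OmegaX X) :
    ∫ x in connectedComponentIn (OmegaX X) m, Omg.indicator W x = 0 := by
  set C := connectedComponentIn (OmegaX X) m with hC
  have hCo : IsOpen C := (isOpen_OmegaX X).connectedComponentIn
  have hmC : m ∈ C := mem_connectedComponentIn hm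
  have hCconn : IsConnected C := ⟨⟨m, hmC⟩, isPreconnected_connectedComponentIn⟩
  have hCO : C ⊆ Icc 0 1 := fun x hx =>
    Ioo_subset_Icc_self (connectedComponentIn_subset _ _ hx).1
  have hbb : BddBelow C := bddBelow_Icc.mono hCO
  have hba : BddAbove C := bddAbove_Icc.mono hCO
  have hcl : closure C ⊆ Icc 0 1 := closure_minimal hCO isClosed_Icc
  have hend : ∀ e ∈ closure C, e ∉ C → primitive W e = 0 := fun e he heC => by
    refine primitive_eq_zero hX hW (hcl he) fun heX => heC ?_
    have hpre : IsPreconnected (insert e C) :=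
      hCconn.isPreconnected.subset_closure (subset_insert e C)
        (insert_subset he subset_closure)
    exact hpre.subset_connectedComponentIn (mem_insert_of_mem e hmC)
      (insert_subset heX (connectedComponentIn_subset _ _)) (mem_insert e C)
  have hinf : sInf C ∉ C := fun h => by
    obtain ⟨a, b, hab, hI⟩ := mem_nhds_iff_exists_Ioo_subset.1 (hCo.mem_nhds h)
    obtain ⟨y, hy1, hy2⟩ := exists_between hab.1
    exact (csInf_le hbb (hI ⟨hy1, hy2.trans hab.2⟩)).not_gt hy2
  have hsup : sSup C ∉ C := fun h => by
    obtain ⟨a, b, hab, hI⟩ := mem_nhds_iff_exists_Ioo_subset.1 (hCo.mem_nhds h)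
    obtain ⟨y, hy1, hy2⟩ := exists_between hab.2
    exact (le_csSup hba (hI ⟨hab.1.trans hy1, hy2⟩)).not_gt hy1
  rw [setIntegral_eq_primitive_sub W ((csInf_le hbb hmC).trans (le_csSup hba hmC))
    (hCconn.Ioo_csInf_csSup_subset hbb hba) (subset_Icc_csInf_csSup hbb hba),
    hend _ (csSup_mem_closure ⟨m, hmC⟩ hba) hsup, hend _ (csInf_mem_closure ⟨m, hmC⟩ hbb) hinf,
    sub_zero]

/-- The normal cone to `K` at `X` is orthogonal to `H_X`. -/
theorem inner_eq_zero_of_mem_normalCone {X W U : L2} (hX : X ∈ Kcone) (hW : W ∈ normalCone X)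
    (hU : U ∈ HX X) : ⟪W, U⟫ = 0 := by
  obtain ⟨u, hUu, hu⟩ := hU
  have hum : MemLp u 2 mu := (Lp.memLp U).ae_eq hUu
  have hint : Integrable (fun x => Omg.indicator W x * u x) := by
    have := (integrable_indicator_iff measurableSet_Omg).2 (integrable_L2_mul W hum)
    refine this.congr (.of_forall fun x => ?_)
    by_cases hx : x ∈ Omg <;> simp [hx]
  let 𝒞 : Set (Set ℝ) := connectedComponentIn (OmegaX X) '' OmegaX X
  have hopen : ∀ C ∈ 𝒞, IsOpen C := by
    rintro _ ⟨m, -, rfl⟩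
    exact (isOpen_OmegaX X).connectedComponentIn
  have hdisj : 𝒞.PairwiseDisjoint id := by
    rintro _ ⟨m, -, rfl⟩ _ ⟨m', -, rfl⟩ hne
    by_contra hnd
    obtain ⟨x, hx, hx'⟩ := not_disjoint_iff.1 hnd
    exact hne ((connectedComponentIn_eq hx).trans (connectedComponentIn_eq hx').symm)
  have hcount : 𝒞.Countable := hdisj.countable_of_isOpen hopen (by
    rintro _ ⟨m, hm, rfl⟩
    exact ⟨m, mem_connectedComponentIn hm⟩)
  have hunion : (⋃ C : 𝒞, (C : Set ℝ)) = OmegaX X := by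
    ext x
    simp only [mem_iUnion, Subtype.exists, exists_prop]
    constructor
    · rintro ⟨_, ⟨m, -, rfl⟩, hx⟩
      exact connectedComponentIn_subset _ _ hx
    · exact fun hx => ⟨_, ⟨x, hx, rfl⟩, mem_connectedComponentIn hx⟩
  have := hcount.to_subtype
  have hzero : ∫ x in OmegaX X, Omg.indicator W x * u x = 0 := by
    rw [← hunion, integral_iUnion (fun C : 𝒞 => (hopen C C.2).measurableSet)
      (fun (C C' : 𝒞) hne => hdisj C.2 C'.2 (Subtype.coe_ne_coe.2 hne)) hint.integrableOn]
    refine (tsum_congr ?_).trans tsum_zero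
    rintro ⟨_, m, hm, rfl⟩
    rw [setIntegral_congr_fun (g := fun x => Omg.indicator W x * u m)
      (isOpen_OmegaX X).connectedComponentIn.measurableSet
      (fun x hx => by simp only [hu m hm x hx]), integral_mul_const,
      setIntegral_component_eq_zero hX hW hm, zero_mul]
  have hW0 := ae_eq_zero_of_notMem_OmegaX hX hW
  calc ⟪W, U⟫ = ∫ x, W x * u x ∂mu := by
        rw [← inner_toLp W hum]
        congr 1
        exact Lp.ext (hUu.trans hum.coeFn_toLp.symm)
    _ = ∫ x, Omg.indicator W x * u x := by
        rw [integral_mu]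
        congr 1
        ext x
        by_cases hx : x ∈ Omg <;> simp [hx]
    _ = ∫ x in OmegaX X, Omg.indicator W x * u x := by
        rw [← integral_indicator (isOpen_OmegaX X).measurableSet]
        refine integral_congr_ae ?_
        filter_upwards [hW0] with x hx
        by_cases hxX : x ∈ OmegaX X
        · simp [hxX]
        · by_cases hxO : x ∈ Omg <;> simp [hxX, hxO, hx]
    _ = 0 := hzero

/-- If `F` is uniformly continuous and `X` is a Lagrangian solution with
data `(X̄, V̄)` and `Y(t) = V̄ + ∫₀ᵗ F[X(s)] ds`, then there is a set `𝒯 ⊆ (0,∞)` of full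
measure in `(0,∞)` such that for every `t ∈ 𝒯` the curve `X` is differentiable at `t` and
`Ẋ(t) = P_{H_{X(t)}}(Y(t))`; in particular `Ẋ(t) ∈ H_{X(t)}` on `𝒯`. -/
theorem stmt10 (F : L2 → L2) (hF : UnifCont F)
    (Xbar : L2) (hXbar : Xbar ∈ Kcone) (Vbar : L2)
    (X : ℝ → L2) (hX : LagSol F Xbar Vbar X) :
    ∃ 𝒯 : Set ℝ, 𝒯 ⊆ Set.Ioi 0 ∧ volume (Set.Ioi (0:ℝ) \ 𝒯) = 0 ∧
      ∀ t ∈ 𝒯, ∃ V : L2, HasDerivAt X V t ∧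
        IsProjHX (X t) (Vbar + ∫ s in Set.Ioc (0:ℝ) t, F (X s)) V ∧
        V ∈ HX (X t) := by
  obtain ⟨hK, -, -, hae⟩ := hX
  refine ⟨{t | 0 < t ∧ ∃ V : L2, HasDerivAt X V t ∧
    (Vbar + ∫ s in Set.Ioc (0:ℝ) t, F (X s)) - V ∈ normalCone (X t)}, fun t ht => ht.1, ?_, ?_⟩
  · rw [ae_restrict_iff' measurableSet_Ioi] at hae
    refine measure_eq_zero_iff_ae_notMem.2 ?_
    filter_upwards [hae] with t ht htd
    exact htd.2 ⟨htd.1, ht htd.1⟩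
  · rintro t ⟨ht, V, hV, hN⟩
    have hH := deriv_mem_HX ht hK hV
    exact ⟨V, hV, ⟨hH, fun U hU => inner_eq_zero_of_mem_normalCone (hK t ht.le) hN hU⟩, hH⟩
end
end

section
/- Suppose F : K → L²(Ω) is uniformly continuous and let X be a Lagrangian solution with initial data (X̄, V̄), with derivative V(t) := Ẋ(t) defined for a.e. t > 0. Then X parametrizes a distributional solution of the pressureless momentum equation: for every smooth compactly supported test function φ : (0,∞) × ℝ → ℝ one has ∫₀^∞ ∫₀¹ [ ∂_t φ(t, X(t)(m)) · V(t)(m) + ∂_x φ(t, X(t)(m)) · V(t)(m)² ] dm dt = − ∫₀^∞ ∫₀¹ φ(t, X(t)(m)) · F[X(t)](m) dm dt. -/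
open MeasureTheory Set Filter
open scoped ENNReal NNReal RealInnerProductSpace

noncomputable section

/-- Dominated convergence in `L²`, for convergence to zero. -/
theorem tendsto_norm_zero_of_dominated {α ι : Type*} {m0 : MeasurableSpace α} {μ : Measure α}
    {l : Filter ι} [l.IsCountablyGenerated] {Q : ι → Lp ℝ 2 μ} {q : ι → α → ℝ} {g : α → ℝ}
    (hg : MemLp g 2 μ) (hQ : ∀ k, Q k =ᵐ[μ] q k) (hb : ∀ᶠ k in l, ∀ᵐ m ∂μ, |q k m| ≤ |g m|)
    (hlim : ∀ᵐ m ∂μ, Tendsto (fun k => q k m) l (nhds 0)) :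
    Tendsto (fun k => ‖Q k‖) l (nhds 0) := by
  have hsq : ∀ k, ‖Q k‖ ^ 2 = ∫ m, q k m ^ 2 ∂μ := fun k => by
    rw [← real_inner_self_eq_norm_sq, L2.inner_def]
    refine integral_congr_ae ?_
    filter_upwards [hQ k] with m hm
    simp [hm, pow_two]
  have h2 : Tendsto (fun k => ‖Q k‖ ^ 2) l (nhds 0) := by
    simp_rw [hsq]
    have := tendsto_integral_filter_of_dominated_convergence (μ := μ) (l := l)
      (F := fun k m => q k m ^ 2) (f := fun _ => 0) (fun m => g m ^ 2)
      (Eventually.of_forall fun k =>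
        (((Lp.aestronglyMeasurable (Q k)).congr (hQ k)).pow 2))
      (by
        filter_upwards [hb] with k hk
        filter_upwards [hk] with m hm
        rw [Real.norm_eq_abs, abs_pow, ← sq_abs (g m)]
        gcongr) hg.integrable_sq
      (by
        filter_upwards [hlim] with m hm
        simpa using hm.pow 2)
    simpa using this
  have h3 := h2.sqrt
  simpa using h3

theorem norm_one_prod_le (v : ℝ) : ‖((1 : ℝ), v)‖ ≤ 1 + |v| := by
  rw [Prod.norm_def]
  simp

theorem LipschitzWith.abs_diffQuotient_le {φ : ℝ × ℝ → ℝ} {L : ℝ≥0} (hL : LipschitzWith L φ)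
    (t x v k : ℝ) : |k⁻¹ * (φ (t + k, x + k * v) - φ (t, x))| ≤ L * (1 + |v|) := by
  rcases eq_or_ne k 0 with rfl | hk
  · simp; positivity
  · have := hL.dist_le_mul (t + k, x + k * v) (t, x)
    rw [dist_eq_norm, dist_eq_norm, show (t + k, x + k * v) - (t, x) =
      k • ((1 : ℝ), v) by ext <;> simp, norm_smul] at this
    rw [abs_mul, abs_inv, inv_mul_le_iff₀ (by positivity)]
    calc |φ (t + k, x + k * v) - φ (t, x)| ≤ L * (|k| * ‖((1 : ℝ), v)‖) := this
      _ ≤ L * (|k| * (1 + |v|)) := by gcongr; exact norm_one_prod_le v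
      _ = _ := by ring

theorem LipschitzWith.abs_fderiv_le {φ : ℝ × ℝ → ℝ} {L : ℝ≥0} (hL : LipschitzWith L φ)
    (p : ℝ × ℝ) (v : ℝ) : |fderiv ℝ φ p (1, v)| ≤ L * (1 + |v|) :=
  calc |fderiv ℝ φ p (1, v)| ≤ ‖fderiv ℝ φ p‖ * ‖((1 : ℝ), v)‖ :=
        (fderiv ℝ φ p).le_opNorm (1, v)
    _ ≤ L * (1 + |v|) := by
        gcongr
        · exact norm_fderiv_le_of_lipschitz ℝ hL
        · exact norm_one_prod_le v

theorem tendsto_diffQuotient {φ : ℝ × ℝ → ℝ} (hd : Differentiable ℝ φ) (t x v : ℝ) :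
    Tendsto (fun k : ℝ => k⁻¹ * (φ (t + k, x + k * v) - φ (t, x))) (nhdsWithin 0 {0}ᶜ)
      (nhds (fderiv ℝ φ (t, x) (1, v))) := by
  have hline : HasDerivAt (fun k : ℝ => ((t + k, x + k * v) : ℝ × ℝ)) (1, v) 0 := by
    refine HasDerivAt.prodMk ((hasDerivAt_id (0 : ℝ)).const_add t) ?_
    simpa using ((hasDerivAt_id (0 : ℝ)).mul_const v).const_add x
  have hcomp : HasDerivAt (fun k : ℝ => φ (t + k, x + k * v)) (fderiv ℝ φ (t, x) (1, v)) 0 := by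
    have h := (hd (t, x)).hasFDerivAt
    refine HasFDerivAt.comp_hasDerivAt (0 : ℝ) ?_ hline
    simpa using h
  rw [hasDerivAt_iff_tendsto_slope_zero] at hcomp
  simpa using hcomp

theorem norm_diffQuotient_sub_le {α : Type*} {m0 : MeasurableSpace α} {μ : Measure α}
    {φ : ℝ × ℝ → ℝ} {L : ℝ≥0} (hL : LipschitzWith L φ) {X₀ X₁ Φ₀ Φ₁ V D Q : Lp ℝ 2 μ} {t k : ℝ}
    (hk : k ≠ 0) (hΦ₀ : Φ₀ =ᵐ[μ] fun m => φ (t, X₀ m))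
    (hΦ₁ : Φ₁ =ᵐ[μ] fun m => φ (t + k, X₁ m))
    (hQ : Q =ᵐ[μ] fun m => k⁻¹ * (φ (t + k, X₀ m + k * V m) - φ (t, X₀ m)) - D m) :
    ‖k⁻¹ • (Φ₁ - Φ₀) - D‖ ≤ ‖Q‖ + L * ‖k⁻¹ • (X₁ - X₀) - V‖ := by
  have key : ‖(k⁻¹ • (Φ₁ - Φ₀) - D) - Q‖ ≤ L * ‖k⁻¹ • (X₁ - X₀) - V‖ := by
    refine Lp.norm_le_mul_norm_of_ae_le_mul ?_
    filter_upwards [Lp.coeFn_sub (k⁻¹ • (Φ₁ - Φ₀) - D) Q,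
      Lp.coeFn_sub (k⁻¹ • (Φ₁ - Φ₀)) D, Lp.coeFn_smul k⁻¹ (Φ₁ - Φ₀),
      Lp.coeFn_sub Φ₁ Φ₀, Lp.coeFn_sub (k⁻¹ • (X₁ - X₀)) V,
      Lp.coeFn_smul k⁻¹ (X₁ - X₀), Lp.coeFn_sub X₁ X₀, hΦ₁, hΦ₀, hQ]
      with m h1 h2 h3 h4 h5 h6 h7 h8 h9 h10
    rw [h1, Pi.sub_apply, h2, Pi.sub_apply, h3, Pi.smul_apply, h4, Pi.sub_apply, h5, Pi.sub_apply,
      h6, Pi.smul_apply, h7, Pi.sub_apply, h8, h9, h10]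
    simp only [smul_eq_mul, Real.norm_eq_abs]
    have := hL.dist_le_mul (t + k, X₁ m) (t + k, X₀ m + k * V m)
    rw [Prod.dist_eq, dist_self, max_eq_right dist_nonneg, Real.dist_eq, Real.dist_eq] at this
    rw [show k⁻¹ * (φ (t + k, X₁ m) - φ (t, X₀ m)) - D m -
      (k⁻¹ * (φ (t + k, X₀ m + k * V m) - φ (t, X₀ m)) - D m) =
      k⁻¹ * (φ (t + k, X₁ m) - φ (t + k, X₀ m + k * V m)) by ring,
      show k⁻¹ * (X₁ m - X₀ m) - V m = k⁻¹ * (X₁ m - (X₀ m + k * V m)) by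
        field_simp; ring, abs_mul, abs_mul]
    calc |k⁻¹| * _ ≤ |k⁻¹| * (L * |X₁ m - (X₀ m + k * V m)|) := by gcongr
      _ = _ := by ring
  have := norm_le_norm_add_norm_sub' (k⁻¹ • (Φ₁ - Φ₀) - D) Q
  linarith

/-- A Lipschitz superposition operator is differentiable along differentiable curves. -/
theorem hasDerivAt_superposition {α : Type*} {m0 : MeasurableSpace α} {μ : Measure α}
    [IsFiniteMeasure μ] {φ : ℝ × ℝ → ℝ} {L : ℝ≥0} (hL : LipschitzWith L φ)
    (hd : Differentiable ℝ φ) {X Φ : ℝ → Lp ℝ 2 μ} {V D : Lp ℝ 2 μ} {t : ℝ}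
    (hX : HasDerivAt X V t) (hΦ : ∀ s, Φ s =ᵐ[μ] fun m => φ (s, X s m))
    (hD : D =ᵐ[μ] fun m => fderiv ℝ φ (t, X t m) (1, V m)) : HasDerivAt Φ D t := by
  have hφc := hd.continuous
  have hmeas : ∀ k : ℝ, AEStronglyMeasurable
      (fun m => k⁻¹ * (φ (t + k, X t m + k * V m) - φ (t, X t m)) - D m) μ := fun k => by
    have hXm := Lp.aestronglyMeasurable (X t)
    have hVm := Lp.aestronglyMeasurable V
    refine AEStronglyMeasurable.sub (AEStronglyMeasurable.const_mul (AEStronglyMeasurable.sub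
      ?_ ?_) _) (Lp.aestronglyMeasurable D)
    · exact hφc.comp_aestronglyMeasurable
        (aestronglyMeasurable_const.prodMk (hXm.add (hVm.const_mul k)))
    · exact hφc.comp_aestronglyMeasurable (aestronglyMeasurable_const.prodMk hXm)
  have hgmem : MemLp (fun m => 2 * (L * (1 + |V m|))) 2 μ := by
    have h1 : MemLp (fun m => |V m|) 2 μ := (Lp.memLp V).abs
    have h2 : MemLp (fun m => 1 + |V m|) 2 μ := (memLp_const (1 : ℝ)).add h1
    exact (h2.const_mul (L : ℝ)).const_mul 2
  have hbd : ∀ k : ℝ, ∀ᵐ m ∂μ, |k⁻¹ * (φ (t + k, X t m + k * V m) - φ (t, X t m)) - D m| ≤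
      |2 * (L * (1 + |V m|))| := fun k => by
    filter_upwards [hD] with m hm
    rw [abs_of_nonneg (a := 2 * (L * (1 + |V m|))) (by positivity)]
    have h1 := hL.abs_diffQuotient_le t (X t m) (V m) k
    have h2 := hL.abs_fderiv_le (t, X t m) (V m)
    rw [← hm] at h2
    refine (abs_sub _ _).trans ?_
    linarith
  have hmem : ∀ k : ℝ, MemLp
      (fun m => k⁻¹ * (φ (t + k, X t m + k * V m) - φ (t, X t m)) - D m) 2 μ :=
    fun k => hgmem.of_le (hmeas k) (by simpa only [Real.norm_eq_abs] using hbd k)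
  have hQ0 : Tendsto (fun k => ‖(hmem k).toLp‖) (nhdsWithin 0 {0}ᶜ) (nhds 0) := by
    refine tendsto_norm_zero_of_dominated hgmem (fun k => (hmem k).coeFn_toLp)
      (Eventually.of_forall hbd) ?_
    filter_upwards [hD] with m hm
    have h := tendsto_diffQuotient hd t (X t m) (V m)
    rw [← hm] at h
    simpa only [sub_self] using h.sub_const (D m)
  rw [hasDerivAt_iff_tendsto_slope_zero] at hX ⊢
  rw [tendsto_iff_norm_sub_tendsto_zero] at hX ⊢
  have hsum := hQ0.add (hX.const_mul (L : ℝ))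
  rw [mul_zero, add_zero] at hsum
  refine squeeze_zero' (Eventually.of_forall fun _ => norm_nonneg _) ?_ hsum
  filter_upwards [self_mem_nhdsWithin] with k hk
  exact norm_diffQuotient_sub_le hL hk (hΦ t) (hΦ (t + k)) (hmem k).coeFn_toLp

instance isProbabilityMeasure_mu : IsProbabilityMeasure mu :=
  ⟨by simp [mu, Omg]⟩

theorem memLp_bounded_comp {g : ℝ → ℝ} {G : ℝ} (hg : Continuous g) (hG : ∀ x, |g x| ≤ G) (X : L2) :
    MemLp (fun m => g (X m)) ⊤ mu :=
  memLp_top_of_bound (hg.comp_aestronglyMeasurable (Lp.aestronglyMeasurable X)) G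
    (Eventually.of_forall fun m => hG (X m))

theorem memLp_mul_bounded_comp {g : ℝ → ℝ} {G : ℝ} (hg : Continuous g) (hG : ∀ x, |g x| ≤ G)
    (W X : L2) : MemLp (fun m => W m * g (X m)) 2 mu :=
  (memLp_bounded_comp hg hG X).mul' (Lp.memLp W)

/-- A perturbation of `X` by `Ψ(X, Z)` that stays in the cone is tested nonpositively by the
normal cone. -/
theorem normalCone_integral_mul_le {X Z W : L2} (hX : X ∈ Kcone) (hZ : Z ∈ Kcone)
    (hW : W ∈ normalCone X) {Ψ : ℝ × ℝ → ℝ} (hΨ : Continuous Ψ) {B : ℝ} (hB : ∀ p, |Ψ p| ≤ B)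
    {ε : ℝ} (hε : 0 < ε)
    (hmono : ∀ x x' z z' : ℝ, x ≤ x' → z ≤ z' → x + ε * Ψ (x, z) ≤ x' + ε * Ψ (x', z')) :
    ∫ m, W m * Ψ (X m, Z m) ∂mu ≤ 0 := by
  have hmem : MemLp (fun m => Ψ (X m, Z m)) 2 mu :=
    MemLp.of_bound (hΨ.comp_aestronglyMeasurable
      ((Lp.aestronglyMeasurable X).prodMk (Lp.aestronglyMeasurable Z))) B
      (Eventually.of_forall fun m => hB _)
  obtain ⟨x, hx, hxX⟩ := hX
  obtain ⟨z, hz, hzZ⟩ := hZ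
  have hK : X + ε • hmem.toLp ∈ Kcone := by
    refine ⟨fun m => x m + ε * Ψ (x m, z m),
      fun a ha b hb hab => hmono _ _ _ _ (hx ha hb hab) (hz ha hb hab), ?_⟩
    filter_upwards [Lp.coeFn_add X (ε • hmem.toLp), Lp.coeFn_smul ε hmem.toLp, hmem.coeFn_toLp,
      hxX, hzZ] with m h1 h2 h3 h4 h5
    rw [h1, Pi.add_apply, h2, Pi.smul_apply, h3, h4, h5, smul_eq_mul]
  have h := hW _ hK
  rw [add_sub_cancel_left, inner_smul_right, L2.inner_def] at h
  have h' := nonpos_of_mul_nonpos_right h hε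
  refine le_of_eq_of_le (integral_congr_ae ?_) h'
  filter_upwards [hmem.coeFn_toLp] with m hm
  rw [hm]
  simp [mul_comm]

theorem normalCone_integral_mul_comp_le {X W : L2} (hX : X ∈ Kcone) (hW : W ∈ normalCone X)
    {g : ℝ → ℝ} {L : ℝ≥0} (hg : LipschitzWith L g) {G : ℝ} (hG : ∀ x, |g x| ≤ G) :
    ∫ m, W m * g (X m) ∂mu ≤ 0 := by
  have hpos : (0 : ℝ) < L + 1 := by positivity
  refine normalCone_integral_mul_le hX hX hW (Ψ := fun p => g p.1) (ε := (L + 1 : ℝ)⁻¹)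
    (hg.continuous.comp continuous_fst) (fun p => hG p.1) (by positivity) ?_
  intro x x' _ _ hx _
  have h := hg.dist_le_mul x x'
  rw [Real.dist_eq, Real.dist_eq, abs_sub_comm x x', abs_of_nonneg (sub_nonneg.2 hx)] at h
  have h1 := (le_abs_self _).trans h
  have h2 : (L + 1 : ℝ)⁻¹ * (g x - g x') ≤ x' - x := by
    rw [inv_mul_le_iff₀ hpos]
    nlinarith
  simp only
  linarith

/-- The normal cone at `X` is orthogonal to bounded Lipschitz functions of `X`. -/
theorem normalCone_integral_mul_comp_eq {X W : L2} (hX : X ∈ Kcone) (hW : W ∈ normalCone X)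
    {g : ℝ → ℝ} {L : ℝ≥0} (hg : LipschitzWith L g) {G : ℝ} (hG : ∀ x, |g x| ≤ G) :
    ∫ m, W m * g (X m) ∂mu = 0 := by
  refine le_antisymm (normalCone_integral_mul_comp_le hX hW hg hG) ?_
  have h := normalCone_integral_mul_comp_le hX hW (g := fun x => -g x) hg.neg
    (G := G) (by simpa using hG)
  simp only [mul_neg, integral_neg] at h
  linarith

/-- Truncation of a real number to `[-n, n]`. -/
def truncate (n : ℕ) (x : ℝ) : ℝ := max (-(n : ℝ)) (min x n)

theorem continuous_truncate (n : ℕ) : Continuous (truncate n) := by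
  unfold truncate
  fun_prop

theorem abs_truncate_le (n : ℕ) (x : ℝ) : |truncate n x| ≤ n :=
  abs_le.2 ⟨le_max_left _ _, max_le (by linarith [Nat.cast_nonneg (α := ℝ) n]) (min_le_right _ _)⟩

theorem abs_truncate_le_abs (n : ℕ) (x : ℝ) : |truncate n x| ≤ |x| := by
  have hn := Nat.cast_nonneg (α := ℝ) n
  unfold truncate
  refine abs_le.2 ⟨?_, max_le (by linarith [abs_nonneg x]) ((min_le_left _ _).trans (le_abs_self x))⟩
  rcases le_total x n with h | h
  · rw [min_eq_left h]
    exact (neg_abs_le x).trans (le_max_right _ _)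
  · rw [min_eq_right h]
    exact le_max_of_le_right (by linarith [abs_nonneg x])

theorem truncate_mono (n : ℕ) : Monotone (truncate n) :=
  fun _ _ h => max_le_max le_rfl (min_le_min h le_rfl)

theorem truncate_sub_le (n : ℕ) {x y : ℝ} (h : x ≤ y) : truncate n y - truncate n x ≤ y - x := by
  unfold truncate
  grind

theorem tendsto_truncate (x : ℝ) : Tendsto (fun n => truncate n x) atTop (nhds x) := by
  refine tendsto_const_nhds.congr' ?_
  obtain ⟨N, hN⟩ := exists_nat_ge |x|
  filter_upwards [eventually_ge_atTop N] with n hn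
  have h : |x| ≤ n := hN.trans (by exact_mod_cast hn)
  rw [abs_le] at h
  rw [truncate, min_eq_left h.2, max_eq_right h.1]

theorem normalCone_integral_mul_truncate_le {X Z W : L2} (hX : X ∈ Kcone) (hZ : Z ∈ Kcone)
    (hW : W ∈ normalCone X) {g : ℝ → ℝ} {L : ℝ≥0} (hg : LipschitzWith L g) {G : ℝ}
    (hG : ∀ x, |g x| ≤ G) (hg0 : ∀ x, 0 ≤ g x) (n : ℕ) :
    ∫ m, W m * (g (X m) * (truncate n (Z m) - truncate n (X m))) ∂mu ≤ 0 := by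
  have hG0 : 0 ≤ G := (abs_nonneg _).trans (hG 0)
  have hpos : (0 : ℝ) < G + 2 * n * L + 1 := by positivity
  refine normalCone_integral_mul_le hX hZ hW
    (Ψ := fun p => g p.1 * (truncate n p.2 - truncate n p.1)) (B := G * (n + n))
    (ε := (G + 2 * n * L + 1 : ℝ)⁻¹) ?_ (fun p => ?_) (by positivity) ?_
  · have := hg.continuous
    have := continuous_truncate n
    fun_prop
  · rw [abs_mul]
    refine mul_le_mul (hG _) ((abs_sub _ _).trans ?_) (abs_nonneg _) hG0
    exact add_le_add (abs_truncate_le _ _) (abs_truncate_le _ _)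
  · intro x x' z z' hx hz
    simp only
    have h := hg.dist_le_mul x x'
    rw [Real.dist_eq, Real.dist_eq, abs_sub_comm x x', abs_of_nonneg (sub_nonneg.2 hx)] at h
    have h1 : 0 ≤ g x' * (truncate n z' - truncate n z) :=
      mul_nonneg (hg0 _) (sub_nonneg.2 (truncate_mono n hz))
    have h2 : g x' * (truncate n x' - truncate n x) ≤ G * (x' - x) :=
      mul_le_mul ((le_abs_self _).trans (hG _)) (truncate_sub_le n hx)
        (sub_nonneg.2 (truncate_mono n hx)) hG0
    have h3 : (g x - g x') * (truncate n z - truncate n x) ≤ (L * (x' - x)) * (n + n) := by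
      refine (le_abs_self _).trans ?_
      rw [abs_mul]
      refine mul_le_mul h ((abs_sub _ _).trans ?_) (abs_nonneg _)
        (mul_nonneg L.2 (sub_nonneg.2 hx))
      exact add_le_add (abs_truncate_le _ _) (abs_truncate_le _ _)
    have h4 : (G + 2 * n * L + 1 : ℝ)⁻¹ * (g x * (truncate n z - truncate n x) -
        g x' * (truncate n z' - truncate n x')) ≤ x' - x := by
      rw [inv_mul_le_iff₀ hpos]
      linarith
    linarith

theorem normalCone_integral_mul_sub_le {X Z W : L2} (hX : X ∈ Kcone) (hZ : Z ∈ Kcone)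
    (hW : W ∈ normalCone X) {g : ℝ → ℝ} {L : ℝ≥0} (hg : LipschitzWith L g) {G : ℝ}
    (hG : ∀ x, |g x| ≤ G) (hg0 : ∀ x, 0 ≤ g x) :
    ∫ m, W m * g (X m) * (Z m - X m) ∂mu ≤ 0 := by
  have hWg := memLp_mul_bounded_comp hg.continuous hG W X
  have hb : MemLp (fun m => |Z m| + |X m|) 2 mu := (Lp.memLp Z).abs.add (Lp.memLp X).abs
  have hXm := Lp.aestronglyMeasurable X
  have hZm := Lp.aestronglyMeasurable Z
  refine le_of_tendsto (f := fun n : ℕ =>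
    ∫ m, W m * g (X m) * (truncate n (Z m) - truncate n (X m)) ∂mu) (x := atTop) ?_
    (Eventually.of_forall fun n => ?_)
  · refine tendsto_integral_of_dominated_convergence
      (fun m => |W m * g (X m)| * (|Z m| + |X m|)) (fun n => ?_) (hWg.abs.integrable_mul hb)
      (fun n => ?_) ?_
    · exact hWg.1.mul (((continuous_truncate n).comp_aestronglyMeasurable hZm).sub
        ((continuous_truncate n).comp_aestronglyMeasurable hXm))
    · refine Eventually.of_forall fun m => ?_
      rw [Real.norm_eq_abs, abs_mul]
      refine mul_le_mul_of_nonneg_left ((abs_sub _ _).trans ?_) (abs_nonneg _)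
      exact add_le_add (abs_truncate_le_abs _ _) (abs_truncate_le_abs _ _)
    · exact Eventually.of_forall fun m =>
        ((tendsto_truncate _).sub (tendsto_truncate _)).const_mul _
  · simpa only [mul_assoc] using normalCone_integral_mul_truncate_le hX hZ hW hg hG hg0 n

theorem inner_toLp_eq {P : ℝ → ℝ} (hP : MemLp P 2 mu) (U : L2) :
    ⟪hP.toLp, U⟫ = ∫ m, P m * U m ∂mu := by
  rw [L2.inner_def]
  refine integral_congr_ae ?_
  filter_upwards [hP.coeFn_toLp] with m hm
  rw [hm]
  simp [mul_comm]

theorem normalCone_integral_mul_deriv_eq_of_nonneg {X : ℝ → L2} {V W : L2} {t : ℝ} (ht : 0 < t)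
    (hXK : ∀ s, 0 ≤ s → X s ∈ Kcone) (hV : HasDerivAt X V t) (hW : W ∈ normalCone (X t))
    {g : ℝ → ℝ} {L : ℝ≥0} (hg : LipschitzWith L g) {G : ℝ}
    (hG : ∀ x, |g x| ≤ G) (hg0 : ∀ x, 0 ≤ g x) :
    ∫ m, W m * g (X t m) * V m ∂mu = 0 := by
  have hP := memLp_mul_bounded_comp hg.continuous hG W (X t)
  rw [← inner_toLp_eq hP]
  have hder : HasDerivAt (fun s => ⟪hP.toLp, X s - X t⟫) ⟪hP.toLp, V⟫ t := by
    simpa using (hasDerivAt_const t hP.toLp).inner ℝ (hV.sub_const (X t))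
  refine IsLocalMax.hasDerivAt_eq_zero ?_ hder
  filter_upwards [lt_mem_nhds ht] with s hs
  simp only [sub_self, inner_zero_right]
  rw [inner_toLp_eq]
  refine le_of_eq_of_le (integral_congr_ae ?_)
    (normalCone_integral_mul_sub_le (hXK t ht.le) (hXK s hs.le) hW hg hG hg0)
  filter_upwards [Lp.coeFn_sub (X s) (X t)] with m hm
  rw [hm, Pi.sub_apply]

/-- Along a differentiable curve `X` in the cone, the normal cone at `X t` is orthogonal to the
product of the velocity and a bounded Lipschitz function of `X t`. -/
theorem normalCone_integral_mul_deriv_eq {X : ℝ → L2} {V W : L2} {t : ℝ} (ht : 0 < t)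
    (hXK : ∀ s, 0 ≤ s → X s ∈ Kcone) (hV : HasDerivAt X V t) (hW : W ∈ normalCone (X t))
    {g : ℝ → ℝ} {L : ℝ≥0} (hg : LipschitzWith L g) {G : ℝ} (hG : ∀ x, |g x| ≤ G) :
    ∫ m, W m * g (X t m) * V m ∂mu = 0 := by
  have hG0 : 0 ≤ G := (abs_nonneg _).trans (hG 0)
  have hconst : LipschitzWith 0 (fun _ : ℝ => G) := LipschitzWith.const G
  have h1 := normalCone_integral_mul_deriv_eq_of_nonneg ht hXK hV hW (hg.add hconst) (G := G + G)
    (fun x => (abs_add_le _ _).trans (add_le_add (hG x) (abs_of_nonneg hG0).le))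
    (fun x => by linarith [neg_abs_le (g x), hG x])
  have h2 := normalCone_integral_mul_deriv_eq_of_nonneg ht hXK hV hW hconst (G := G)
    (fun x => (abs_of_nonneg hG0).le) (fun x => hG0)
  have hi1 : Integrable (fun m => W m * g (X t m) * V m) mu :=
    (memLp_mul_bounded_comp hg.continuous hG W (X t)).integrable_mul (Lp.memLp V)
  have hi2 : Integrable (fun m => W m * G * V m) mu :=
    ((Lp.memLp W).mul_const G).integrable_mul (Lp.memLp V)
  have h3 : ∫ m, W m * (g (X t m) + G) * V m ∂mu =
      ∫ m, W m * g (X t m) * V m ∂mu + ∫ m, W m * G * V m ∂mu := by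
    rw [← integral_add hi1 hi2]
    congr 1 with m
    ring
  rw [h3, h2, add_zero] at h1
  exact h1

theorem UnifCont.continuousOn_comp {F : L2 → L2} (hF : UnifCont F) {X : ℝ → L2} {s : Set ℝ}
    (hXK : ∀ t ∈ s, X t ∈ Kcone) (hX : ContinuousOn X s) : ContinuousOn (fun t => F (X t)) s := by
  obtain ⟨-, ω, hωc, -, -, hω0, -, hω⟩ := hF
  intro t ht
  rw [ContinuousWithinAt, tendsto_iff_norm_sub_tendsto_zero]
  have h1 : Tendsto (fun r => ‖X r - X t‖) (nhdsWithin t s) (nhdsWithin 0 (Set.Ici 0)) :=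
    tendsto_nhdsWithin_iff.2 ⟨tendsto_iff_norm_sub_tendsto_zero.1 (hX t ht),
      Eventually.of_forall fun _ => norm_nonneg _⟩
  have h2 := (hωc 0 (Set.mem_Ici.2 le_rfl)).tendsto.comp h1
  rw [hω0] at h2
  refine squeeze_zero' (Eventually.of_forall fun _ => norm_nonneg _) ?_ h2
  filter_upwards [self_mem_nhdsWithin] with r hr
  exact hω _ (hXK r hr) _ (hXK t ht)

theorem hasDerivAt_setIntegral_Ioc {E : Type*} [NormedAddCommGroup E] [NormedSpace ℝ E]
    [CompleteSpace E] {f : ℝ → E} (hf : ContinuousOn f (Set.Ici 0)) (v : E) {t : ℝ} (ht : 0 < t) :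
    HasDerivAt (fun u => v + ∫ s in Set.Ioc (0 : ℝ) u, f s) (f t) t := by
  have hint : IntervalIntegrable f volume 0 t :=
    (hf.mono (by rw [Set.uIcc_of_le ht.le]; exact Set.Icc_subset_Ici_self)).intervalIntegrable
  have hc : ContinuousOn f (Set.Ioi 0) := hf.mono Set.Ioi_subset_Ici_self
  have h := (intervalIntegral.integral_hasDerivAt_right hint
    (hc.stronglyMeasurableAtFilter isOpen_Ioi t ht)
    (hc.continuousAt (Ioi_mem_nhds ht))).const_add v
  refine h.congr_of_eventuallyEq ?_
  filter_upwards [lt_mem_nhds ht] with u hu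
  rw [intervalIntegral.integral_of_le hu.le]

theorem deriv_fst_slice {φ : ℝ × ℝ → ℝ} (hd : Differentiable ℝ φ) (t x : ℝ) :
    deriv (fun s : ℝ => φ (s, x)) t = fderiv ℝ φ (t, x) (1, 0) :=
  ((hd (t, x)).hasFDerivAt.comp_hasDerivAt t
    ((hasDerivAt_id t).prodMk (hasDerivAt_const t x))).deriv

theorem deriv_snd_slice {φ : ℝ × ℝ → ℝ} (hd : Differentiable ℝ φ) (t x : ℝ) :
    deriv (fun y : ℝ => φ (t, y)) x = fderiv ℝ φ (t, x) (0, 1) :=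
  ((hd (t, x)).hasFDerivAt.comp_hasDerivAt x
    ((hasDerivAt_const x t).prodMk (hasDerivAt_id x))).deriv

theorem fderiv_apply_one_eq (φ : ℝ × ℝ → ℝ) (p : ℝ × ℝ) (v : ℝ) :
    fderiv ℝ φ p (1, v) = fderiv ℝ φ p (1, 0) + fderiv ℝ φ p (0, 1) * v := by
  have h : ((1 : ℝ), v) = (1, 0) + v • ((0 : ℝ), (1 : ℝ)) := by ext <;> simp
  rw [h, map_add, map_smul, smul_eq_mul, mul_comm]

theorem norm_superposition_sub_le {α : Type*} {m0 : MeasurableSpace α} {μ : Measure α}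
    [IsProbabilityMeasure μ] {φ : ℝ × ℝ → ℝ} {L : ℝ≥0} (hL : LipschitzWith L φ)
    {X₀ X₁ Φ₀ Φ₁ : Lp ℝ 2 μ} {t₀ t₁ : ℝ} (h₀ : Φ₀ =ᵐ[μ] fun m => φ (t₀, X₀ m))
    (h₁ : Φ₁ =ᵐ[μ] fun m => φ (t₁, X₁ m)) :
    ‖Φ₁ - Φ₀‖ ≤ L * (|t₁ - t₀| + ‖X₁ - X₀‖) := by
  have hc : MemLp (fun _ : α => |t₁ - t₀|) 2 μ := memLp_const _
  have hX : MemLp (fun m => |(X₁ - X₀) m|) 2 μ := (Lp.memLp (X₁ - X₀)).abs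
  have hcn : ‖hc.toLp‖ ≤ |t₁ - t₀| := by
    rw [Lp.norm_toLp, eLpNorm_const _ (by simp) (IsProbabilityMeasure.ne_zero μ)]
    simp
  have hXn : ‖hX.toLp‖ ≤ ‖X₁ - X₀‖ := by
    refine Lp.norm_le_norm_of_ae_le ?_
    filter_upwards [hX.coeFn_toLp] with m hm
    rw [hm]
    simp
  have h : ‖Φ₁ - Φ₀‖ ≤ L * ‖hc.toLp + hX.toLp‖ := by
    refine Lp.norm_le_mul_norm_of_ae_le_mul ?_
    filter_upwards [Lp.coeFn_sub Φ₁ Φ₀, Lp.coeFn_sub X₁ X₀, Lp.coeFn_add hc.toLp hX.toLp,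
      hc.coeFn_toLp, hX.coeFn_toLp, h₀, h₁] with m e1 e2 e3 e4 e5 e6 e7
    rw [e1, e3, Pi.sub_apply, Pi.add_apply, e4, e5, e6, e7, e2, Pi.sub_apply]
    have h := hL.dist_le_mul (t₁, X₁ m) (t₀, X₀ m)
    rw [Prod.dist_eq, Real.dist_eq, Real.dist_eq, Real.dist_eq] at h
    rw [Real.norm_eq_abs, Real.norm_eq_abs, abs_of_nonneg (a := _ + _) (by positivity)]
    refine h.trans (mul_le_mul_of_nonneg_left ?_ L.2)
    exact max_le_add_of_nonneg (abs_nonneg _) (abs_nonneg _)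
  refine h.trans (mul_le_mul_of_nonneg_left ?_ L.2)
  exact (norm_add_le _ _).trans (add_le_add hcn hXn)

/-- Time derivative of the pairing of `φ(t, X t)` with the momentum `Y t` of a Lagrangian
solution. -/
theorem hasDerivAt_inner_momentum {φ : ℝ × ℝ → ℝ} (hφ : ContDiff ℝ (⊤ : ℕ∞) φ)
    (hsupp : HasCompactSupport φ) {X Φ Y : ℝ → L2} {V A : L2} {t : ℝ} (ht : 0 < t)
    (hΦ : ∀ s, Φ s =ᵐ[mu] fun m => φ (s, X s m)) (hXK : ∀ s, 0 ≤ s → X s ∈ Kcone)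
    (hV : HasDerivAt X V t) (hY : HasDerivAt Y A t) (hW : Y t - V ∈ normalCone (X t)) :
    HasDerivAt (fun s => ⟪Φ s, Y s⟫)
      (⟪Φ t, A⟫ + ∫ m, (deriv (fun s : ℝ => φ (s, X t m)) t * V m +
          deriv (fun y : ℝ => φ (t, y)) (X t m) * (V m) ^ 2) ∂mu) t := by
  obtain ⟨L, hL⟩ := hφ.lipschitzWith_of_hasCompactSupport hsupp (by simp)
  have hd : Differentiable ℝ φ := hφ.differentiable (by simp)
  have hslice : ∀ w : ℝ × ℝ, ∃ K : ℝ≥0, ∃ B : ℝ,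
      LipschitzWith K (fun x => fderiv ℝ φ (t, x) w) ∧ ∀ x, |fderiv ℝ φ (t, x) w| ≤ B := fun w => by
    have hc : HasCompactSupport (fun p => fderiv ℝ φ p w) := hsupp.fderiv_apply ℝ w
    have hs : ContDiff ℝ 1 (fun p => fderiv ℝ φ p w) :=
      (hφ.fderiv_right (m := 1) (WithTop.coe_le_coe.2 le_top)).clm_apply contDiff_const
    obtain ⟨K, hK⟩ := hs.lipschitzWith_of_hasCompactSupport hc (by simp)
    obtain ⟨B, hB⟩ := hc.exists_bound_of_continuous hs.continuous
    refine ⟨K * 1, B, hK.comp (LipschitzWith.prodMk_left t), fun x => hB (t, x)⟩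
  obtain ⟨K₁, B₁, hK₁, hB₁⟩ := hslice (1, 0)
  obtain ⟨K₂, B₂, hK₂, hB₂⟩ := hslice (0, 1)
  have hm₁ : MemLp (fun m => fderiv ℝ φ (t, X t m) (1, 0)) 2 mu :=
    (memLp_bounded_comp hK₁.continuous hB₁ (X t)).mono_exponent le_top
  have hm₂ : MemLp (fun m => V m * fderiv ℝ φ (t, X t m) (0, 1)) 2 mu :=
    memLp_mul_bounded_comp hK₂.continuous hB₂ V (X t)
  have hmD : MemLp (fun m => fderiv ℝ φ (t, X t m) (1, V m)) 2 mu := by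
    refine (hm₁.add hm₂).ae_eq (Eventually.of_forall fun m => ?_)
    simp only [Pi.add_apply]
    rw [fderiv_apply_one_eq φ _ (V m), mul_comm (V m)]
  have hΦd : HasDerivAt Φ hmD.toLp t := hasDerivAt_superposition hL hd hV hΦ hmD.coeFn_toLp
  have hder := hΦd.inner ℝ hY
  have h₁ := normalCone_integral_mul_comp_eq (hXK t ht.le) hW hK₁ hB₁
  have h₂ := normalCone_integral_mul_deriv_eq ht hXK hV hW hK₂ hB₂
  have i₁ : Integrable (fun m => (Y t - V) m * fderiv ℝ φ (t, X t m) (1, 0)) mu :=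
    (Lp.memLp (Y t - V)).integrable_mul hm₁
  have i₂ : Integrable (fun m => (Y t - V) m * fderiv ℝ φ (t, X t m) (0, 1) * V m) mu :=
    (memLp_mul_bounded_comp hK₂.continuous hB₂ (Y t - V) (X t)).integrable_mul (Lp.memLp V)
  have i₃ : Integrable (fun m => fderiv ℝ φ (t, X t m) (1, V m) * V m) mu :=
    hmD.integrable_mul (Lp.memLp V)
  have hsplit : ⟪hmD.toLp, Y t⟫ = ∫ m, (deriv (fun s : ℝ => φ (s, X t m)) t * V m +
      deriv (fun y : ℝ => φ (t, y)) (X t m) * (V m) ^ 2) ∂mu := by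
    calc ⟪hmD.toLp, Y t⟫ = ∫ m, fderiv ℝ φ (t, X t m) (1, V m) * Y t m ∂mu := inner_toLp_eq hmD _
      _ = ∫ m, (fderiv ℝ φ (t, X t m) (1, V m) * V m +
            ((Y t - V) m * fderiv ℝ φ (t, X t m) (1, 0) +
              (Y t - V) m * fderiv ℝ φ (t, X t m) (0, 1) * V m)) ∂mu := by
          refine integral_congr_ae ?_
          filter_upwards [Lp.coeFn_sub (Y t) V] with m hm
          rw [hm, Pi.sub_apply, fderiv_apply_one_eq φ _ (V m)]
          ring
      _ = ∫ m, fderiv ℝ φ (t, X t m) (1, V m) * V m ∂mu := by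
          rw [integral_add i₃ (i₁.fun_add i₂), integral_add i₁ i₂, h₁, h₂, add_zero, add_zero]
      _ = _ := by
          congr 1 with m
          rw [deriv_fst_slice hd, deriv_snd_slice hd, fderiv_apply_one_eq φ _ (V m)]
          ring
  rwa [hsplit] at hder

/-- A compact subset of the open right half-plane lies in a vertical strip. -/
theorem exists_strip {S : Set (ℝ × ℝ)} (hS : IsCompact S)
    (hS' : S ⊆ Set.Ioi (0 : ℝ) ×ˢ (Set.univ : Set ℝ)) :
    ∃ a b : ℝ, 0 < a ∧ a ≤ b ∧ ∀ p ∈ S, p.1 ∈ Set.Ioo a b := by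
  rcases S.eq_empty_or_nonempty with rfl | hne
  · exact ⟨1, 1, one_pos, le_rfl, by simp⟩
  · obtain ⟨p, hp, hpm⟩ := hS.exists_isMinOn hne continuous_fst.continuousOn
    obtain ⟨q, hq, hqm⟩ := hS.exists_isMaxOn hne continuous_fst.continuousOn
    have hp0 : 0 < p.1 := (hS' hp).1
    have hpq : p.1 ≤ q.1 := hpm hq
    exact ⟨p.1 / 2, q.1 + 1, by linarith, by linarith, fun r hr =>
      ⟨by linarith [show p.1 ≤ r.1 from hpm hr], by linarith [show r.1 ≤ q.1 from hqm hr]⟩⟩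

theorem lipschitzOnWith_inner {E : Type*} [NormedAddCommGroup E] [InnerProductSpace ℝ E]
    {f g : ℝ → E} {s : Set ℝ} {Kf Kg Bf Bg : ℝ≥0} (hf : LipschitzOnWith Kf f s)
    (hg : LipschitzOnWith Kg g s) (hBf : ∀ t ∈ s, ‖f t‖ ≤ Bf) (hBg : ∀ t ∈ s, ‖g t‖ ≤ Bg) :
    LipschitzOnWith (Kf * Bg + Bf * Kg) (fun t => ⟪f t, g t⟫) s := by
  refine LipschitzOnWith.of_dist_le_mul fun x hx y hy => ?_
  have h1 := hf.dist_le_mul x hx y hy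
  have h2 := hg.dist_le_mul x hx y hy
  rw [dist_eq_norm] at h1 h2
  rw [Real.dist_eq, show ⟪f x, g x⟫ - ⟪f y, g y⟫ = ⟪f x - f y, g x⟫ + ⟪f y, g x - g y⟫ by
    rw [inner_sub_left, inner_sub_right]; ring]
  push_cast
  calc _ ≤ |⟪f x - f y, g x⟫| + |⟪f y, g x - g y⟫| := abs_add_le _ _
    _ ≤ ‖f x - f y‖ * ‖g x‖ + ‖f y‖ * ‖g x - g y‖ :=
        add_le_add (abs_real_inner_le_norm _ _) (abs_real_inner_le_norm _ _)
    _ ≤ (Kf * dist x y) * Bg + Bf * (Kg * dist x y) := by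
        gcongr
        · exact hBg x hx
        · exact hBf y hy
    _ = _ := by ring

theorem ContinuousOn.exists_nnreal_bound {E : Type*} [NormedAddCommGroup E] {f : ℝ → E} {s : Set ℝ}
    (hs : IsCompact s) (hf : ContinuousOn f s) : ∃ B : ℝ≥0, ∀ t ∈ s, ‖f t‖ ≤ B := by
  obtain ⟨C, hC⟩ := hs.exists_bound_of_continuousOn hf
  exact ⟨C.toNNReal, fun t ht => (hC t ht).trans (Real.le_coe_toNNReal C)⟩

/-- A Lagrangian solution parametrizes a distributional solution of the
pressureless momentum equation: for every smooth test function `φ` compactly supported in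
`(0,∞) × ℝ`,
`∫₀^∞ ∫₀¹ [∂_t φ(t, X(t)(m)) V(t)(m) + ∂_x φ(t, X(t)(m)) V(t)(m)²] dm dt
  = − ∫₀^∞ ∫₀¹ φ(t, X(t)(m)) F[X(t)](m) dm dt`. -/
theorem stmt11 (F : L2 → L2) (hF : UnifCont F)
    (Xbar : L2) (hXbar : Xbar ∈ Kcone) (Vbar : L2)
    (X : ℝ → L2) (hX : LagSol F Xbar Vbar X)
    (V : ℝ → L2)
    (hV : ∀ᵐ t ∂(volume.restrict (Set.Ioi (0:ℝ))), HasDerivAt X (V t) t)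
    (φ : ℝ × ℝ → ℝ) (hφ : ContDiff ℝ (⊤ : ℕ∞) φ) (hsupp : HasCompactSupport φ)
    (hsupp' : tsupport φ ⊆ Set.Ioi (0:ℝ) ×ˢ (Set.univ : Set ℝ)) :
    (∫ t in Set.Ioi (0:ℝ),
        ∫ m, (deriv (fun s : ℝ => φ (s, X t m)) t * V t m +
          deriv (fun y : ℝ => φ (t, y)) (X t m) * (V t m) ^ 2) ∂mu) =
      -∫ t in Set.Ioi (0:ℝ), ∫ m, φ (t, X t m) * F (X t) m ∂mu := by

  obtain ⟨hXK, -, hXL, hXN⟩ := hX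
  obtain ⟨L, hL⟩ := hφ.lipschitzWith_of_hasCompactSupport hsupp (by simp)
  have hd : Differentiable ℝ φ := hφ.differentiable (by simp)
  obtain ⟨a, b, ha, hab, hstrip⟩ := exists_strip hsupp.isCompact hsupp'
  obtain ⟨C, hC⟩ := hsupp.exists_bound_of_continuous hφ.continuous
  have hmem : ∀ t, MemLp (fun m => φ (t, X t m)) 2 mu := fun t =>
    MemLp.of_bound (hφ.continuous.comp_aestronglyMeasurable
      (aestronglyMeasurable_const.prodMk (Lp.aestronglyMeasurable (X t)))) C
      (Eventually.of_forall fun m => hC _)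
  obtain ⟨Φ, hΦ⟩ : ∃ Φ : ℝ → L2, ∀ t, Φ t =ᵐ[mu] fun m => φ (t, X t m) :=
    ⟨fun t => (hmem t).toLp, fun t => (hmem t).coeFn_toLp⟩
  have hXc : ContinuousOn X (Set.Ici 0) := fun t ht => by
    obtain ⟨K, hK⟩ := hXL (t + 1)
    refine (hK.continuousOn t ⟨ht, by linarith⟩).mono_of_mem_nhdsWithin ?_
    filter_upwards [self_mem_nhdsWithin, nhdsWithin_le_nhds (gt_mem_nhds (lt_add_one t))]
      with s hs hs'
    exact ⟨hs, hs'.le⟩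
  have hFc : ContinuousOn (fun t => F (X t)) (Set.Ici 0) := hF.continuousOn_comp hXK hXc
  set Y : ℝ → L2 := fun t => Vbar + ∫ s in Set.Ioc (0 : ℝ) t, F (X s) with hYdef
  have hYd : ∀ t, 0 < t → HasDerivAt Y (F (X t)) t := fun t ht =>
    hasDerivAt_setIntegral_Ioc hFc Vbar ht
  have hpos : ∀ t ∈ Set.Icc a b, 0 < t := fun t ht => ha.trans_le ht.1
  have hFab : ContinuousOn (fun t => F (X t)) (Set.Icc a b) :=
    hFc.mono fun t ht => (hpos t ht).le
  have hΦL : ∃ K : ℝ≥0, LipschitzOnWith K Φ (Set.Icc a b) := by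
    obtain ⟨K, hK⟩ := hXL b
    refine ⟨L * (1 + K), LipschitzOnWith.of_dist_le_mul fun x hx y hy => ?_⟩
    have h := hK.dist_le_mul x ⟨(hpos x hx).le, hx.2⟩ y ⟨(hpos y hy).le, hy.2⟩
    rw [dist_eq_norm, Real.dist_eq] at h
    rw [dist_eq_norm, Real.dist_eq]
    refine (norm_superposition_sub_le hL (hΦ y) (hΦ x)).trans ?_
    push_cast
    rw [mul_assoc]
    refine mul_le_mul_of_nonneg_left ?_ L.2
    linarith
  have hYL : ∃ K : ℝ≥0, LipschitzOnWith K Y (Set.Icc a b) := by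
    obtain ⟨K, hK⟩ := hFab.exists_nnreal_bound isCompact_Icc
    exact ⟨K, (convex_Icc a b).lipschitzOnWith_of_nnnorm_hasDerivWithin_le
      (fun t ht => (hYd t (hpos t ht)).hasDerivWithinAt) hK⟩
  obtain ⟨KΦ, hKΦ⟩ := hΦL
  obtain ⟨KY, hKY⟩ := hYL
  obtain ⟨BΦ, hBΦ⟩ := hKΦ.continuousOn.exists_nnreal_bound isCompact_Icc
  obtain ⟨BY, hBY⟩ := hKY.continuousOn.exists_nnreal_bound isCompact_Icc
  have hLip := lipschitzOnWith_inner hKΦ hKY hBΦ hBY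
  rw [← Set.uIcc_of_le hab] at hLip
  have hac := hLip.absolutelyContinuousOnInterval
  have hzero : ∀ t, t ∉ Set.Ioo a b → ∀ x, (t, x) ∉ tsupport φ := fun t ht x hx =>
    ht (hstrip _ hx)
  have hΦzero : ∀ t, t ∉ Set.Ioo a b → Φ t = 0 := fun t ht => by
    refine Lp.ext ?_
    filter_upwards [hΦ t, Lp.coeFn_zero ℝ 2 mu] with m h1 h2
    rw [h1, h2, image_eq_zero_of_notMem_tsupport (hzero t ht _)]
    rfl
  have hrhs : ∀ t, ∫ m, φ (t, X t m) * F (X t) m ∂mu = ⟪Φ t, F (X t)⟫ := fun t => by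
    rw [L2.inner_def]
    refine integral_congr_ae ?_
    filter_upwards [hΦ t] with m hm
    rw [hm]
    simp [mul_comm]
  have hfd : ∀ t, t ∉ Set.Ioo a b → ∀ x, fderiv ℝ φ (t, x) = 0 := fun t ht x =>
    image_eq_zero_of_notMem_tsupport fun h => hzero t ht x (tsupport_fderiv_subset ℝ h)
  have hsub : Set.Ioc a b ⊆ Set.Ioi 0 := fun t ht => ha.trans ht.1
  have hnot : ∀ t, t ∈ Set.Ioi (0 : ℝ) \ Set.Ioc a b → t ∉ Set.Ioo a b := fun t ht h =>
    ht.2 (Set.Ioo_subset_Ioc_self h)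
  have hint : IntervalIntegrable (fun t => ⟪Φ t, F (X t)⟫) volume a b := by
    refine ContinuousOn.intervalIntegrable ?_
    rw [Set.uIcc_of_le hab]
    exact hKΦ.continuousOn.inner hFab
  have hder : ∀ᵐ t ∂volume.restrict (Set.Ioc a b),
      ∫ m, (deriv (fun s : ℝ => φ (s, X t m)) t * V t m +
          deriv (fun y : ℝ => φ (t, y)) (X t m) * (V t m) ^ 2) ∂mu =
        deriv (fun s => ⟪Φ s, Y s⟫) t - ⟪Φ t, F (X t)⟫ := by
    filter_upwards [ae_restrict_of_ae_restrict_of_subset hsub hV,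
      ae_restrict_of_ae_restrict_of_subset hsub hXN, ae_restrict_mem measurableSet_Ioc]
      with t h1 ⟨V', h2, h3⟩ ht
    rw [h2.unique h1] at h3
    have ht0 : 0 < t := hsub ht
    rw [(hasDerivAt_inner_momentum hφ hsupp ht0 hΦ hXK h1 (hYd t ht0) h3).deriv]
    ring
  have hftc := hac.integral_deriv_eq_sub
  rw [hΦzero a (by simp), hΦzero b (by simp), inner_zero_left, inner_zero_left, sub_zero] at hftc
  simp_rw [hrhs]
  rw [setIntegral_eq_of_subset_of_forall_sdiff_eq_zero measurableSet_Ioi hsub,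
    setIntegral_eq_of_subset_of_forall_sdiff_eq_zero (f := fun t => ⟪Φ t, F (X t)⟫)
      measurableSet_Ioi hsub, integral_congr_ae hder, ← intervalIntegral.integral_of_le hab,
    ← intervalIntegral.integral_of_le hab,
    intervalIntegral.integral_sub hac.intervalIntegrable_deriv hint, hftc, zero_sub]
  · intro t ht
    rw [hΦzero t (hnot t ht), inner_zero_left]
  · intro t ht
    simp_rw [deriv_fst_slice hd, deriv_snd_slice hd, hfd t (hnot t ht)]
    simp
end
end
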